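/- Consider a K-class N-agent system with finite state space X, finite action space U, class sizes N_1,...,N_K, total population N_pop = Σ_k N_k, and discount factor γ ∈ [0,1), in which rewards, transitions and decision rules depend only on aggregate (marginal) distributions: for each class k, r_k : X × U × P(X) × P(U) → ℝ with |r_k| ≤ M_R and Lipschitz constant L_R in (μ[X],ν[U]) (with respect to |·|₁), P_k : X × U × P(X) × P(U) → P(X) with Lipschitz constant L_P, and decision rules π_k^t : X × P(X) → P(U) with Lipschitz constant L_Q. The N-agent process evolves as usual: actions sampled independently from π_k^t(x^{t,N}_{j,k}, μ_t^N[X]) and next states independently from P_k(x^{t,N}_{j,k}, u^{t,N}_{j,k}, μ_t^N[X], ν_t^N[U]), where μ_t^N ∈ P(X×[K]) and ν_t^N ∈ P(U×[K]) are the empirical joint distributions and μ[X], ν[U] denote their marginals on X resp. U. Let v^N(x^N_0, π) be the population-averaged expected γ-discounted total reward and let v^MF(μ_0, π) be its mean-field limit, defined by the deterministic flow μ_{t+1}(x',k) = Σ_{x,u} μ_t(x,k)·π_k^t(x,μ_t[X])(u)·P_k(x,u,μ_t[X],ν_t[U])(x') with ν_t(u,k) = Σ_x π_k^t(x,μ_t[X])(u)·μ_t(x,k),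 and v^MF(μ_0,π) = Σ_k Σ_t γ^t Σ_{x,u} μ_t(x,k)·π_k^t(x,μ_t[X])(u)·r_k(x,u,μ_t[X],ν_t[U]). Set C_R = M_R + L_R, C_P = 2 + L_P, S_R' = M_R + L_R, S_R'' = M_R·L_Q + L_R(1+L_Q), S_P' = 1 + L_P, S_P'' = L_Q + L_P(1+L_Q), S_R = S_R' + S_R'', S_P = S_P' + S_P''. If γ·S_P < 1 and μ_0 is the empirical joint distribution of the initial states x^N_0, then |v^N(x^N_0,π) − v^MF(μ_0,π)| ≤ (C_R/(1−γ))·√|U|·(1/√N_pop) + √(|X||U|)·(γ·C_P/(1−γ))·[ (S_R'/N_pop)·Σ_k √N_k + S_R''/√N_pop ] + C_P·(S_R/(S_P−1))·√(|X||U|)·(γ/(1−γS_P) − γ/(1−γ))·[ (S_P'/N_pop)·Σ_k √N_k + S_P''/√N_pop ]. -/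

import Mathlib

open MeasureTheory ProbabilityTheory Finset

/-- A probability distribution on a finite type, represented as a nonnegative
function summing to one. -/
def IsProb {A : Type*} [Fintype A] (μ : A → ℝ) : Prop :=
  (∀ a, 0 ≤ μ a) ∧ ∑ a, μ a = 1

/-- The L1 distance between two real-valued functions on a finite type. -/
noncomputable def l1 {A : Type*} [Fintype A] (μ ν : A → ℝ) : ℝ :=
  ∑ a, |μ a - ν a|

/-- The marginal on `A` of a distribution on `A × Fin K`. -/
def marg {A : Type*} [Fintype A] {K : ℕ} (μ : A × Fin K → ℝ) : A → ℝ :=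
  fun a => ∑ k, μ (a, k)

set_option linter.unusedSectionVars false

section FiniteProb

set_option linter.unusedSectionVars false
set_option linter.unusedVariables false

variable {I A : Type*} [Fintype I] [Fintype A] [DecidableEq I]

/-- product weight -/
def Wt (p : I → A → ℝ) (y : I → A) : ℝ := ∏ i, p i (y i)

lemma Wt_nonneg {p : I → A → ℝ} (hp : ∀ i, IsProb (p i)) (y : I → A) : 0 ≤ Wt p y :=
  Finset.prod_nonneg fun i _ => (hp i).1 _

lemma sum_prod_fun (q : I → A → ℝ) : ∑ y : I → A, ∏ i, q i (y i) = ∏ i, ∑ a, q i a := by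
  rw [Finset.prod_univ_sum]; simp

lemma Wt_sum {p : I → A → ℝ} (hp : ∀ i, IsProb (p i)) : ∑ y, Wt p y = 1 := by
  unfold Wt
  rw [sum_prod_fun]
  exact Finset.prod_eq_one fun i _ => (hp i).2

lemma Wt_single {p : I → A → ℝ} (hp : ∀ i, IsProb (p i)) (i : I) (f : A → ℝ) :
    ∑ y, Wt p y * f (y i) = ∑ a, p i a * f a := by
  have h : ∀ y : I → A, Wt p y * f (y i) = ∏ l, (p l (y l) * if l = i then f (y l) else 1) := by
    intro y
    rw [Finset.prod_mul_distrib, Finset.prod_ite_eq' Finset.univ i (fun l => f (y l))]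
    simp [Wt]
  simp_rw [h]
  rw [sum_prod_fun (fun l a => p l a * if l = i then f a else 1)]
  rw [Finset.prod_eq_single i]
  · simp
  · intro l _ hl
    simp [hl, (hp l).2]
  · simp

lemma Wt_pair {p : I → A → ℝ} (hp : ∀ i, IsProb (p i)) (h : I → A → ℝ)
    (h0 : ∀ i, ∑ a, p i a * h i a = 0) (i j : I) (hij : i ≠ j) :
    ∑ y, Wt p y * (h i (y i) * h j (y j)) = 0 := by
  have e : ∀ y : I → A, Wt p y * (h i (y i) * h j (y j)) =
      ∏ l, (p l (y l) * ((if l = i then h i (y l) else 1) * (if l = j then h j (y l) else 1))) := by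
    intro y
    rw [Finset.prod_mul_distrib, Finset.prod_mul_distrib,
      Finset.prod_ite_eq' Finset.univ i (fun l => h i (y l)),
      Finset.prod_ite_eq' Finset.univ j (fun l => h j (y l))]
    simp [Wt]
  simp_rw [e]
  rw [sum_prod_fun (fun l a => p l a * ((if l = i then h i a else 1) * (if l = j then h j a else 1)))]
  apply Finset.prod_eq_zero (Finset.mem_univ i)
  simp [hij, h0]

lemma Wt_var {p : I → A → ℝ} (hp : ∀ i, IsProb (p i)) (h : I → A → ℝ)
    (h0 : ∀ i, ∑ a, p i a * h i a = 0) :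
    ∑ y, Wt p y * (∑ i, h i (y i)) ^ 2 = ∑ i, ∑ a, p i a * h i a ^ 2 := by
  have e : ∀ y : I → A, Wt p y * (∑ i, h i (y i)) ^ 2 =
      ∑ i, ∑ j, Wt p y * (h i (y i) * h j (y j)) := by
    intro y
    rw [sq, Finset.sum_mul_sum, Finset.mul_sum]
    simp_rw [Finset.mul_sum]
  simp_rw [e]
  rw [Finset.sum_comm]
  refine Finset.sum_congr rfl fun i _ => ?_
  rw [Finset.sum_comm, Finset.sum_eq_single i]
  · simp_rw [← sq]
    exact Wt_single hp i (fun a => h i a ^ 2)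
  · intro j _ hj
    exact Wt_pair hp h h0 i j (Ne.symm hj)
  · simp

lemma wmean_abs_le {Y : Type*} [Fintype Y] (w f : Y → ℝ) (hw : ∀ y, 0 ≤ w y) (h1 : ∑ y, w y = 1) :
    ∑ y, w y * |f y| ≤ Real.sqrt (∑ y, w y * f y ^ 2) := by
  apply Real.le_sqrt_of_sq_le
  have := Finset.sum_sq_le_sum_mul_sum_of_sq_le_mul Finset.univ (r := fun y => w y * |f y|)
    (f := w) (g := fun y => w y * f y ^ 2) (fun y _ => hw y)
    (fun y _ => mul_nonneg (hw y) (sq_nonneg _))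
    (fun y _ => le_of_eq (by rw [mul_pow, sq_abs]; ring))
  rw [h1, one_mul] at this
  exact this

lemma conc1 {p : I → A → ℝ} (hp : ∀ i, IsProb (p i)) (g : I → A → ℝ) :
    ∑ y, Wt p y * |∑ i, (g i (y i) - ∑ a, p i a * g i a)|
      ≤ Real.sqrt (∑ i, ∑ a, p i a * g i a ^ 2) := by
  refine (wmean_abs_le _ _ (Wt_nonneg hp) (Wt_sum hp)).trans ?_
  apply Real.sqrt_le_sqrt
  rw [Wt_var hp (fun i a => g i a - ∑ a, p i a * g i a)]
  · refine Finset.sum_le_sum fun i _ => ?_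
    set m := ∑ a, p i a * g i a with hm
    have : ∑ a, p i a * (g i a - m) ^ 2 = ∑ a, p i a * g i a ^ 2 - m ^ 2 := by
      have : ∀ a, p i a * (g i a - m) ^ 2 = p i a * g i a ^ 2 - 2 * m * (p i a * g i a)
        + m ^ 2 * p i a := fun a => by ring
      simp_rw [this, Finset.sum_add_distrib, Finset.sum_sub_distrib, ← Finset.mul_sum, ← hm,
        (hp i).2]
      ring
    rw [this]
    nlinarith [sq_nonneg m]
  · intro i
    simp_rw [mul_sub, Finset.sum_sub_distrib, ← Finset.sum_mul, (hp i).2]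
    ring

lemma sum_sqrt_le {B : Type*} [Fintype B] (v : B → ℝ) (hv : ∀ b, 0 ≤ v b) :
    ∑ b, Real.sqrt (v b) ≤ Real.sqrt (Fintype.card B * ∑ b, v b) := by
  apply Real.le_sqrt_of_sq_le
  have := Finset.sum_sq_le_sum_mul_sum_of_sq_le_mul Finset.univ (r := fun b => Real.sqrt (v b))
    (f := fun _ => (1:ℝ)) (g := v) (fun y _ => zero_le_one)
    (fun y _ => hv y) (fun y _ => le_of_eq (by rw [Real.sq_sqrt (hv y), one_mul]))
  simpa using this

/-- family concentration -/
lemma concQ {B Q : Type*} [Fintype B] [Fintype Q] {p : I → A → ℝ} (hp : ∀ i, IsProb (p i))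
    (g : B → I → A → ℝ) (hg0 : ∀ b i a, 0 ≤ g b i a) (hg : ∀ i a, ∑ b, g b i a = 1)
    (h : Q → I → ℝ) (hh0 : ∀ q i, 0 ≤ h q i) (hh1 : ∀ q i, h q i ≤ 1) :
    ∑ y, Wt p y * ∑ q, ∑ b, |∑ i, h q i * (g b i (y i) - ∑ a, p i a * g b i a)|
      ≤ Real.sqrt (Fintype.card B) * ∑ q, Real.sqrt (∑ i, h q i) := by
  have hg1 : ∀ b i a, g b i a ≤ 1 := fun b i a => by
    rw [← hg i a]
    exact Finset.single_le_sum (f := fun b => g b i a) (fun b _ => hg0 b i a) (Finset.mem_univ b)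
  simp_rw [Finset.mul_sum]
  rw [Finset.sum_comm]
  refine Finset.sum_le_sum fun q _ => ?_
  rw [Finset.sum_comm]
  have key : ∀ b, ∑ y, Wt p y * |∑ i, h q i * (g b i (y i) - ∑ a, p i a * g b i a)|
      ≤ Real.sqrt (∑ i, h q i * ∑ a, p i a * g b i a) := by
    intro b
    have := conc1 hp (fun i a => h q i * g b i a)
    have e : ∀ i (y : I → A), h q i * g b i (y i) - ∑ a, p i a * (h q i * g b i a)
        = h q i * (g b i (y i) - ∑ a, p i a * g b i a) := by
      intro i y
      rw [mul_sub, Finset.mul_sum]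
      congr 1
      exact Finset.sum_congr rfl fun a _ => by ring
    simp_rw [e] at this
    refine this.trans (Real.sqrt_le_sqrt ?_)
    refine Finset.sum_le_sum fun i _ => ?_
    rw [Finset.mul_sum]
    refine Finset.sum_le_sum fun a _ => ?_
    have h1 : (h q i * g b i a) ^ 2 ≤ h q i * g b i a := by
      have := mul_nonneg (hh0 q i) (hg0 b i a)
      have h2 := mul_le_one₀ (hh1 q i) (hg0 b i a) (hg1 b i a)
      nlinarith
    calc p i a * (h q i * g b i a) ^ 2 ≤ p i a * (h q i * g b i a) :=
          mul_le_mul_of_nonneg_left h1 ((hp i).1 a)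
      _ = _ := by ring
  refine (Finset.sum_le_sum fun b _ => key b).trans ?_
  refine (sum_sqrt_le _ fun b => Finset.sum_nonneg fun i _ => mul_nonneg (hh0 q i)
    (Finset.sum_nonneg fun a _ => mul_nonneg ((hp i).1 a) (hg0 b i a))).trans ?_
  rw [← Real.sqrt_mul (Nat.cast_nonneg _)]
  apply le_of_eq
  congr 2
  rw [Finset.sum_comm]
  refine Finset.sum_congr rfl fun i _ => ?_
  rw [← Finset.mul_sum, Finset.sum_comm]
  simp_rw [← Finset.mul_sum, hg, mul_one, (hp i).2, mul_one]

/-- mixture lemma -/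
lemma mixM {S B : Type*} [Fintype S] [Fintype B] (μ μ' : S → ℝ) (F F' : S → B → ℝ) (M δ : ℝ)
    (hM : ∀ s, ∑ a, |F s a| ≤ M) (hδ : ∀ s, ∑ a, |F s a - F' s a| ≤ δ) (hμ : ∀ s, 0 ≤ μ' s) :
    ∑ a, |∑ s, μ s * F s a - ∑ s, μ' s * F' s a| ≤ M * ∑ s, |μ s - μ' s| + δ * ∑ s, μ' s := by
  have h1 : ∀ a, |∑ s, μ s * F s a - ∑ s, μ' s * F' s a| ≤
      ∑ s, (|μ s - μ' s| * |F s a| + μ' s * |F s a - F' s a|) := by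
    intro a
    rw [← Finset.sum_sub_distrib]
    refine (Finset.abs_sum_le_sum_abs _ _).trans (Finset.sum_le_sum fun s _ => ?_)
    have : μ s * F s a - μ' s * F' s a = (μ s - μ' s) * F s a + μ' s * (F s a - F' s a) := by ring
    rw [this]
    refine (abs_add_le _ _).trans ?_
    rw [abs_mul, abs_mul, abs_of_nonneg (hμ s)]
  refine (Finset.sum_le_sum fun a _ => h1 a).trans ?_
  rw [Finset.sum_comm, Finset.mul_sum, Finset.mul_sum, ← Finset.sum_add_distrib]
  refine Finset.sum_le_sum fun s _ => ?_
  rw [Finset.sum_add_distrib, ← Finset.mul_sum, ← Finset.mul_sum]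
  have := mul_le_mul_of_nonneg_left (hM s) (abs_nonneg (μ s - μ' s))
  have := mul_le_mul_of_nonneg_left (hδ s) (hμ s)
  linarith

lemma l1_nonneg (m n : A → ℝ) : 0 ≤ l1 m n := Finset.sum_nonneg fun _ _ => abs_nonneg _

lemma l1_tri (m n o : A → ℝ) : l1 m o ≤ l1 m n + l1 n o := by
  unfold l1
  rw [← Finset.sum_add_distrib]
  exact Finset.sum_le_sum fun a _ => abs_sub_le _ _ _

lemma l1_self (m : A → ℝ) : l1 m m = 0 := by simp [l1]

lemma l1_marg {K : ℕ} (m n : A × Fin K → ℝ) : l1 (marg m) (marg n) ≤ l1 m n := by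
  unfold l1 marg
  rw [Fintype.sum_prod_type]
  refine Finset.sum_le_sum fun a _ => ?_
  rw [← Finset.sum_sub_distrib]
  exact Finset.abs_sum_le_sum_abs _ _

lemma IsProb.marg {K : ℕ} {m : A × Fin K → ℝ} (h : IsProb m) : IsProb (marg m) := by
  refine ⟨fun a => Finset.sum_nonneg fun k _ => h.1 _, ?_⟩
  rw [← h.2, Fintype.sum_prod_type]; rfl

lemma IsProb.sum_abs {m : A → ℝ} (h : IsProb m) : ∑ a, |m a| = 1 := by
  rw [← h.2]; exact Finset.sum_congr rfl fun a _ => abs_of_nonneg (h.1 a)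

end FiniteProb


/-- Data of the aggregate mean-field system. -/
structure MFS (X U : Type*) [Fintype X] [Fintype U] (K : ℕ) where
  MR : ℝ
  LR : ℝ
  LP : ℝ
  LQ : ℝ
  hMR : 0 ≤ MR
  hLR : 0 ≤ LR
  hLP : 0 ≤ LP
  hLQ : 0 ≤ LQ
  r : Fin K → X → U → (X → ℝ) → (U → ℝ) → ℝ
  hrBdd : ∀ k x u m n, IsProb m → IsProb n → |r k x u m n| ≤ MR
  hrLip : ∀ k x u m₁ n₁ m₂ n₂, IsProb m₁ → IsProb n₁ → IsProb m₂ → IsProb n₂ →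
      |r k x u m₁ n₁ - r k x u m₂ n₂| ≤ LR * (l1 m₁ m₂ + l1 n₁ n₂)
  Pk : Fin K → X → U → (X → ℝ) → (U → ℝ) → X → ℝ
  hPkProb : ∀ k x u m n, IsProb m → IsProb n → IsProb (Pk k x u m n)
  hPkLip : ∀ k x u m₁ n₁ m₂ n₂, IsProb m₁ → IsProb n₁ → IsProb m₂ → IsProb n₂ →
      l1 (Pk k x u m₁ n₁) (Pk k x u m₂ n₂) ≤ LP * (l1 m₁ m₂ + l1 n₁ n₂)
  pi : ℕ → Fin K → X → (X → ℝ) → U → ℝ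
  hpiProb : ∀ t k x m, IsProb m → IsProb (pi t k x m)
  hpiLip : ∀ t k x m₁ m₂, IsProb m₁ → IsProb m₂ →
      l1 (pi t k x m₁) (pi t k x m₂) ≤ LQ * l1 m₁ m₂

namespace MFS

variable {X U : Type*} [Fintype X] [Fintype U] {K : ℕ} (S : MFS X U K)

noncomputable def nuM (t : ℕ) (μ : X × Fin K → ℝ) : U × Fin K → ℝ :=
  fun p => ∑ x, μ (x, p.2) * S.pi t p.2 x (marg μ) p.1

/-- averaged kernel -/
noncomputable def avP (t : ℕ) (k : Fin K) (x : X) (m : X → ℝ) (n : U → ℝ) (x1 : X) : ℝ :=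
  ∑ u, S.pi t k x m u * S.Pk k x u m n x1

noncomputable def avr (t : ℕ) (k : Fin K) (x : X) (m : X → ℝ) (n : U → ℝ) : ℝ :=
  ∑ u, S.pi t k x m u * S.r k x u m n

noncomputable def PM (t : ℕ) (μ : X × Fin K → ℝ) : X × Fin K → ℝ :=
  fun p => ∑ x, μ (x, p.2) * S.avP t p.2 x (marg μ) (marg (S.nuM t μ)) p.1

noncomputable def rM (t : ℕ) (μ : X × Fin K → ℝ) : ℝ :=
  ∑ k, ∑ x, μ (x, k) * S.avr t k x (marg μ) (marg (S.nuM t μ))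

def SP1 : ℝ := 1 + S.LP
def SP2 : ℝ := S.LQ + S.LP * (1 + S.LQ)
def SR1 : ℝ := S.MR + S.LR
def SR2 : ℝ := S.MR * S.LQ + S.LR * (1 + S.LQ)

variable {S}

lemma joint_prob {A B : Type*} [Fintype A] [Fintype B] {μ : A × Fin K → ℝ} (hμ : IsProb μ)
    {F : Fin K → A → B → ℝ} (hF : ∀ k a, IsProb (F k a)) :
    IsProb (fun p : B × Fin K => ∑ a, μ (a, p.2) * F p.2 a p.1) := by
  refine ⟨fun p => Finset.sum_nonneg fun a _ => mul_nonneg (hμ.1 _) ((hF _ _).1 _), ?_⟩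
  rw [Fintype.sum_prod_type, Finset.sum_comm]
  have e : ∑ k, ∑ a, μ (a, k) = 1 := by
    rw [← hμ.2, Fintype.sum_prod_type, Finset.sum_comm]
  rw [← e]
  refine Finset.sum_congr rfl fun k _ => ?_
  rw [Finset.sum_comm]
  refine Finset.sum_congr rfl fun a _ => ?_
  dsimp only
  rw [← Finset.mul_sum, (hF k a).2, mul_one]

lemma joint_mix {A B : Type*} [Fintype A] [Fintype B] {μ μ' : A × Fin K → ℝ} (hμ : IsProb μ')
    {F F' : Fin K → A → B → ℝ} (M δ : ℝ) (hM : ∀ k s, ∑ a, |F k s a| ≤ M)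
    (hδ : ∀ k s, ∑ a, |F k s a - F' k s a| ≤ δ) :
    ∑ k, ∑ b, |∑ a, μ (a, k) * F k a b - ∑ a, μ' (a, k) * F' k a b| ≤ M * l1 μ μ' + δ := by
  have : ∀ k, ∑ b, |∑ a, μ (a, k) * F k a b - ∑ a, μ' (a, k) * F' k a b| ≤ 
      M * ∑ a, |μ (a, k) - μ' (a, k)| + δ * ∑ a, μ' (a, k) := fun k =>
    mixM (fun a => μ (a, k)) (fun a => μ' (a, k)) (F k) (F' k) M δ (hM k) (hδ k) (fun a => hμ.1 _)
  refine (Finset.sum_le_sum fun k _ => this k).trans (le_of_eq ?_)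
  rw [Finset.sum_add_distrib, ← Finset.mul_sum, ← Finset.mul_sum]
  have e : ∑ k, ∑ a, μ' (a, k) = 1 := by
    rw [← hμ.2, Fintype.sum_prod_type, Finset.sum_comm]
  rw [e, mul_one]
  unfold l1
  rw [Fintype.sum_prod_type, Finset.sum_comm]

lemma avP_prob (t k x) {m : X → ℝ} {n : U → ℝ} (hm : IsProb m) (hn : IsProb n) :
    IsProb (S.avP t k x m n) := by
  refine ⟨fun p => Finset.sum_nonneg fun a _ => mul_nonneg ((S.hpiProb t k x m hm).1 a)
    ((S.hPkProb k x a m n hm hn).1 p), ?_⟩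
  unfold avP
  rw [Finset.sum_comm]
  simp_rw [← Finset.mul_sum, (S.hPkProb k x _ m n hm hn).2, mul_one]
  exact (S.hpiProb t k x m hm).2

lemma nuM_prob (t) {μ : X × Fin K → ℝ} (hμ : IsProb μ) : IsProb (S.nuM t μ) :=
  joint_prob hμ fun k a => S.hpiProb t k a _ hμ.marg

lemma PM_prob (t) {μ : X × Fin K → ℝ} (hμ : IsProb μ) : IsProb (S.PM t μ) :=
  joint_prob hμ fun k a => avP_prob t k a hμ.marg (nuM_prob t hμ).marg

lemma nuM_lip (t) {μ μ' : X × Fin K → ℝ} (hμ : IsProb μ) (hμ' : IsProb μ') :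
    l1 (S.nuM t μ) (S.nuM t μ') ≤ l1 μ μ' + S.LQ * l1 (marg μ) (marg μ') := by
  have := joint_mix (μ := μ) hμ' (F := fun k a => S.pi t k a (marg μ))
    (F' := fun k a => S.pi t k a (marg μ')) 1 (S.LQ * l1 (marg μ) (marg μ'))
    (fun k s => (S.hpiProb t k s _ hμ.marg).sum_abs.le)
    (fun k s => S.hpiLip t k s _ _ hμ.marg hμ'.marg)
  rw [one_mul] at this
  refine le_trans (le_of_eq ?_) this
  unfold l1
  rw [Fintype.sum_prod_type, Finset.sum_comm]; rfl

lemma avP_lip (t k x) {m m' : X → ℝ} {n n' : U → ℝ} (hm : IsProb m) (hn : IsProb n)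
    (hm' : IsProb m') (hn' : IsProb n') :
    ∑ x1, |S.avP t k x m n x1 - S.avP t k x m' n' x1| ≤
      S.LQ * l1 m m' + S.LP * (l1 m m' + l1 n n') := by
  have := mixM (S.pi t k x m) (S.pi t k x m') (fun u => S.Pk k x u m n)
    (fun u => S.Pk k x u m' n') 1 (S.LP * (l1 m m' + l1 n n'))
    (fun u => (S.hPkProb k x u m n hm hn).sum_abs.le)
    (fun u => S.hPkLip k x u _ _ _ _ hm hn hm' hn') (S.hpiProb t k x m' hm').1
  rw [(S.hpiProb t k x m' hm').2, one_mul, mul_one] at this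
  have h2 : _ ≤ _ := S.hpiLip t k x m m' hm hm'
  unfold l1 at h2 ⊢
  unfold l1 at this
  unfold avP
  linarith

lemma avr_lip (t k x) {m m' : X → ℝ} {n n' : U → ℝ} (hm : IsProb m) (hn : IsProb n)
    (hm' : IsProb m') (hn' : IsProb n') :
    |S.avr t k x m n - S.avr t k x m' n'| ≤
      S.MR * (S.LQ * l1 m m') + S.LR * (l1 m m' + l1 n n') := by
  have := mixM (S.pi t k x m) (S.pi t k x m') (fun u (_ : Unit) => S.r k x u m n)
    (fun u _ => S.r k x u m' n') S.MR (S.LR * (l1 m m' + l1 n n'))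
    (fun u => by simpa using S.hrBdd k x u m n hm hn)
    (fun u => by simpa using S.hrLip k x u _ _ _ _ hm hn hm' hn') (S.hpiProb t k x m' hm').1
  rw [(S.hpiProb t k x m' hm').2, mul_one] at this
  simp only [Finset.univ_unique, Finset.sum_const, Finset.card_singleton, one_smul] at this
  have h2 := mul_le_mul_of_nonneg_left (S.hpiLip t k x m m' hm hm') S.hMR
  unfold l1 at h2 ⊢
  unfold l1 at this
  unfold avr
  linarith

lemma avr_bdd (t k x) {m : X → ℝ} {n : U → ℝ} (hm : IsProb m) (hn : IsProb n) :
    |S.avr t k x m n| ≤ S.MR := by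
  unfold avr
  refine (Finset.abs_sum_le_sum_abs _ _).trans ?_
  have h := S.hpiProb t k x m hm
  rw [← mul_one S.MR, ← h.2, Finset.mul_sum]
  refine Finset.sum_le_sum fun u _ => ?_
  rw [abs_mul, abs_of_nonneg (h.1 u), mul_comm]
  exact mul_le_mul_of_nonneg_right (S.hrBdd k x u m n hm hn) (h.1 u)

lemma PM_lip (t) {μ μ' : X × Fin K → ℝ} (hμ : IsProb μ) (hμ' : IsProb μ') :
    l1 (S.PM t μ) (S.PM t μ') ≤ S.SP1 * l1 μ μ' + S.SP2 * l1 (marg μ) (marg μ') := by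
  have hn := (nuM_prob (S := S) t hμ).marg
  have hn' := (nuM_prob (S := S) t hμ').marg
  have := joint_mix (μ := μ) hμ' (F := fun k a => S.avP t k a (marg μ) (marg (S.nuM t μ)))
    (F' := fun k a => S.avP t k a (marg μ') (marg (S.nuM t μ'))) 1 _
    (fun k s => (avP_prob t k s hμ.marg hn).sum_abs.le)
    (fun k s => avP_lip t k s hμ.marg hn hμ'.marg hn')
  have h3 := le_trans (a := l1 (S.PM t μ) (S.PM t μ')) (le_of_eq (by
    unfold l1
    rw [Fintype.sum_prod_type, Finset.sum_comm]; rfl)) this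
  have h4 := mul_le_mul_of_nonneg_left
    ((l1_marg (S.nuM t μ) (S.nuM t μ')).trans (nuM_lip t hμ hμ')) S.hLP
  unfold SP1 SP2
  linarith

lemma rM_lip (t) {μ μ' : X × Fin K → ℝ} (hμ : IsProb μ) (hμ' : IsProb μ') :
    |S.rM t μ - S.rM t μ'| ≤ S.SR1 * l1 μ μ' + S.SR2 * l1 (marg μ) (marg μ') := by
  have hn := (nuM_prob (S := S) t hμ).marg
  have hn' := (nuM_prob (S := S) t hμ').marg
  have := joint_mix (μ := μ) hμ' (B := Unit)
    (F := fun k a _ => S.avr t k a (marg μ) (marg (S.nuM t μ)))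
    (F' := fun k a _ => S.avr t k a (marg μ') (marg (S.nuM t μ'))) S.MR _
    (fun k s => by simpa using avr_bdd t k s hμ.marg hn)
    (fun k s => by simpa using avr_lip t k s hμ.marg hn hμ'.marg hn')
  have h3 := le_trans (a := |S.rM t μ - S.rM t μ'|) (by
    unfold rM
    rw [← Finset.sum_sub_distrib]
    refine (Finset.abs_sum_le_sum_abs _ _).trans (le_of_eq ?_)
    simp) this
  have h4 := mul_le_mul_of_nonneg_left
    ((l1_marg (S.nuM t μ) (S.nuM t μ')).trans (nuM_lip t hμ hμ')) S.hLR
  unfold SR1 SR2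
  linarith

end MFS


section Emp

set_option linter.unusedSectionVars false
variable {X U : Type*} [Fintype X] [Fintype U] {K : ℕ} {S : MFS X U K}
variable {I A : Type*} [Fintype I] [DecidableEq I] [Nonempty I] [Fintype A]
variable [DecidableEq A] [DecidableEq X] [DecidableEq U]

noncomputable def emp (κ : I → Fin K) (c : I → A) : A × Fin K → ℝ :=
  fun p => (∑ i, (if κ i = p.2 then 1 else 0) * (if c i = p.1 then 1 else 0)) / (Fintype.card I : ℝ)

lemma card_pos' : (0:ℝ) < (Fintype.card I : ℝ) := by exact_mod_cast Fintype.card_pos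

lemma emp_mix (κ : I → Fin K) (c : I → A) (k : Fin K) (F : A → ℝ) :
    ∑ a, emp κ c (a, k) * F a = (∑ i, (if κ i = k then 1 else 0) * F (c i)) / (Fintype.card I : ℝ) := by
  unfold emp
  simp_rw [div_mul_eq_mul_div, ← Finset.sum_div, Finset.sum_mul]
  rw [Finset.sum_comm]
  congr 1
  refine Finset.sum_congr rfl fun i _ => ?_
  simp

lemma emp_mix_marg (κ : I → Fin K) (c : I → A) (F : Fin K → A → ℝ) :
    ∑ k, ∑ a, emp κ c (a, k) * F k a = (∑ i, F (κ i) (c i)) / (Fintype.card I : ℝ) := by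
  simp_rw [emp_mix]
  rw [← Finset.sum_div, Finset.sum_comm]
  simp

lemma marg_emp (κ : I → Fin K) (c : I → A) (a : A) :
    marg (emp κ c) a = (∑ i, if c i = a then 1 else 0) / (Fintype.card I : ℝ) := by
  unfold marg emp
  rw [← Finset.sum_div, Finset.sum_comm]
  congr 1
  refine Finset.sum_congr rfl fun i _ => ?_
  simp

lemma emp_prob (κ : I → Fin K) (c : I → A) : IsProb (emp κ c) := by
  refine ⟨fun p => div_nonneg (Finset.sum_nonneg fun i _ => by positivity) (Nat.cast_nonneg _), ?_⟩
  have := emp_mix_marg κ c (fun _ _ => 1)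
  rw [Fintype.sum_prod_type, Finset.sum_comm]
  simp only [mul_one] at this
  rw [this]
  simp

noncomputable def pA (S : MFS X U K) (κ : I → Fin K) (t : ℕ) (c : I → X) (i : I) : U → ℝ :=
  S.pi t (κ i) (c i) (marg (emp κ c))

noncomputable def pB (S : MFS X U K) (κ : I → Fin K) (c : I → X) (d : I → U) (i : I) : X → ℝ :=
  S.Pk (κ i) (c i) (d i) (marg (emp κ c)) (marg (emp κ d))

lemma pA_prob (κ : I → Fin K) (t : ℕ) (c : I → X) (i : I) : IsProb (pA S κ t c i) :=
  S.hpiProb _ _ _ _ (emp_prob κ c).marg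

lemma pB_prob (κ : I → Fin K) (c : I → X) (d : I → U) (i : I) : IsProb (pB S κ c d i) :=
  S.hPkProb _ _ _ _ _ (emp_prob κ c).marg (emp_prob κ d).marg

lemma marg_nuM (κ : I → Fin K) (t : ℕ) (c : I → X) (u : U) :
    marg (S.nuM t (emp κ c)) u = (∑ i, pA S κ t c i u) / (Fintype.card I : ℝ) :=
  emp_mix_marg κ c (fun k x => S.pi t k x (marg (emp κ c)) u)

lemma sqrt_div_self' : Real.sqrt (Fintype.card I : ℝ) / (Fintype.card I : ℝ)
    = 1 / Real.sqrt (Fintype.card I : ℝ) := by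
  rw [Real.sqrt_div_self, one_div]

/-- concentration for indicators -/
lemma concInd {Q : Type*} [Fintype Q] {p : I → A → ℝ} (hp : ∀ i, IsProb (p i))
    (h : Q → I → ℝ) (hh0 : ∀ q i, 0 ≤ h q i) (hh1 : ∀ q i, h q i ≤ 1) :
    ∑ y, Wt p y * ∑ q, ∑ b, |∑ i, h q i * ((if y i = b then 1 else 0) - p i b)|
      ≤ Real.sqrt (Fintype.card A) * ∑ q, Real.sqrt (∑ i, h q i) := by
  have := concQ hp (B := A) (fun b _ a => if a = b then 1 else 0)
    (fun b i a => by positivity) (fun i a => by simp) h hh0 hh1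
  simpa using this

lemma emp_conc {p : I → A → ℝ} (hp : ∀ i, IsProb (p i)) (κ : I → Fin K) (m : A → ℝ)
    (hm : ∀ a, m a = (∑ i, p i a) / (Fintype.card I : ℝ)) :
    ∑ y, Wt p y * l1 (marg (emp κ y)) m ≤
      Real.sqrt (Fintype.card A) * (1 / Real.sqrt (Fintype.card I)) := by
  have := concInd hp (Q := Unit) (fun _ _ => 1) (by simp) (by simp)
  have e : ∀ y, l1 (marg (emp κ y)) m =
      (∑ q : Unit, ∑ b, |∑ i, 1 * ((if y i = b then 1 else 0) - p i b)|) / Fintype.card I := by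
    intro y
    unfold l1
    simp only [Finset.univ_unique, Finset.sum_const, Finset.card_singleton, one_smul, one_mul]
    rw [Finset.sum_div]
    refine Finset.sum_congr rfl fun b _ => ?_
    rw [marg_emp, hm, ← sub_div, ← Finset.sum_sub_distrib, abs_div, Nat.abs_cast]
  rw [← sqrt_div_self', mul_div]
  simp_rw [e, mul_div, ← Finset.sum_div]
  refine div_le_div_of_nonneg_right ?_ (Nat.cast_nonneg _)
  simpa using this

lemma nu_conc (κ : I → Fin K) (t : ℕ) (c : I → X) :
    ∑ d, Wt (pA S κ t c) d * l1 (marg (emp κ d)) (marg (S.nuM t (emp κ c))) ≤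
      Real.sqrt (Fintype.card U) * (1 / Real.sqrt (Fintype.card I)) :=
  emp_conc (pA_prob κ t c) κ _ (marg_nuM κ t c)

lemma sqrt_sum_le' {Q : Type*} [Fintype Q] (v : Q → ℝ) (hv : ∀ b, 0 ≤ v b) :
    Real.sqrt (∑ b, v b) ≤ ∑ b, Real.sqrt (v b) := by
  refine Real.sqrt_le_iff.2 ⟨Finset.sum_nonneg fun b _ => Real.sqrt_nonneg _, ?_⟩
  rw [sq, Finset.sum_mul]
  refine Finset.sum_le_sum fun b _ => ?_
  calc v b = Real.sqrt (v b) * Real.sqrt (v b) := (Real.mul_self_sqrt (hv b)).symm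
    _ ≤ _ := mul_le_mul_of_nonneg_left (Finset.single_le_sum (f := fun b => Real.sqrt (v b))
      (fun b _ => Real.sqrt_nonneg _) (Finset.mem_univ b)) (Real.sqrt_nonneg _)

lemma step_core {Q : Type*} [Fintype Q] (κ : I → Fin K) (t : ℕ) (c : I → X)
    [Nonempty X] [Nonempty U]
    (h : Q → I → ℝ) (hh0 : ∀ q i, 0 ≤ h q i) (hh1 : ∀ i, ∑ q, h q i = 1) :
    ∑ d, Wt (pA S κ t c) d * ∑ c', Wt (pB S κ c d) c' *
      ∑ q, ∑ x, |∑ i, h q i * ((if c' i = x then 1 else 0) -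
        S.avP t (κ i) (c i) (marg (emp κ c)) (marg (S.nuM t (emp κ c))) x)|
      ≤ (2 + S.LP) * Real.sqrt ((Fintype.card X : ℝ) * Fintype.card U) *
        ∑ q, Real.sqrt (∑ i, h q i) := by
  have hle1 : ∀ q i, h q i ≤ 1 := fun q i => by
    rw [← hh1 i]
    exact Finset.single_le_sum (f := fun q => h q i) (fun b _ => hh0 b i) (Finset.mem_univ q)
  set m := marg (emp κ c) with hm
  set nb := marg (S.nuM t (emp κ c)) with hnb
  have pm : IsProb m := (emp_prob κ c).marg
  have pn : IsProb nb := (MFS.nuM_prob t (emp_prob κ c)).marg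
  set Z := ∑ q, Real.sqrt (∑ i, h q i) with hZ
  have hZ0 : 0 ≤ Z := Finset.sum_nonneg fun b _ => Real.sqrt_nonneg _
  have hcardZ : Real.sqrt (Fintype.card I) ≤ Z := by
    have := sqrt_sum_le' (fun q => ∑ i, h q i) (fun q => Finset.sum_nonneg fun i _ => hh0 q i)
    rw [Finset.sum_comm] at this
    simpa [hh1] using this
  -- decomposition
  have T1 : ∀ d, ∑ c', Wt (pB S κ c d) c' *
      ∑ q, ∑ x, |∑ i, h q i * ((if c' i = x then 1 else 0) - pB S κ c d i x)|
      ≤ Real.sqrt (Fintype.card X) * Z := fun d => concInd (pB_prob κ c d) h hh0 hle1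
  have T3 : ∑ d, Wt (pA S κ t c) d *
      ∑ q, ∑ x, |∑ i, h q i * (S.Pk (κ i) (c i) (d i) m nb x - S.avP t (κ i) (c i) m nb x)|
      ≤ Real.sqrt (Fintype.card X) * Z :=
    concQ (pA_prob κ t c) (fun x i u => S.Pk (κ i) (c i) u m nb x)
      (fun x i u => (S.hPkProb _ _ _ _ _ pm pn).1 x) (fun i u => (S.hPkProb _ _ _ _ _ pm pn).2)
      h hh0 hle1
  have T2 : ∀ d, ∑ q, ∑ x, |∑ i, h q i * (pB S κ c d i x - S.Pk (κ i) (c i) (d i) m nb x)|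
      ≤ Fintype.card I * (S.LP * l1 (marg (emp κ d)) nb) := by
    intro d
    calc _ ≤ ∑ q, ∑ x, ∑ i, h q i * |pB S κ c d i x - S.Pk (κ i) (c i) (d i) m nb x| := by
          refine Finset.sum_le_sum fun q _ => Finset.sum_le_sum fun x _ => ?_
          refine (Finset.abs_sum_le_sum_abs _ _).trans (Finset.sum_le_sum fun i _ => ?_)
          rw [abs_mul, abs_of_nonneg (hh0 q i)]
      _ = ∑ i, l1 (pB S κ c d i) (S.Pk (κ i) (c i) (d i) m nb) := by
          simp_rw [Finset.sum_comm (s := (Finset.univ : Finset X)) (t := (Finset.univ : Finset I)),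
            ← Finset.mul_sum]
          rw [Finset.sum_comm]
          simp_rw [← Finset.sum_mul, hh1, one_mul]
          rfl
      _ ≤ ∑ i : I, S.LP * l1 (marg (emp κ d)) nb := by
          refine Finset.sum_le_sum fun i _ => ?_
          have := S.hPkLip (κ i) (c i) (d i) m (marg (emp κ d)) m nb pm (emp_prob κ d).marg pm pn
          rwa [l1_self, zero_add] at this
      _ = _ := by simp
  have main : ∀ d, ∑ c', Wt (pB S κ c d) c' *
      ∑ q, ∑ x, |∑ i, h q i * ((if c' i = x then 1 else 0) - S.avP t (κ i) (c i) m nb x)|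
      ≤ Real.sqrt (Fintype.card X) * Z + Fintype.card I * (S.LP * l1 (marg (emp κ d)) nb) +
        ∑ q, ∑ x, |∑ i, h q i * (S.Pk (κ i) (c i) (d i) m nb x - S.avP t (κ i) (c i) m nb x)| := by
    intro d
    set R := ∑ q, ∑ x, |∑ i, h q i * (S.Pk (κ i) (c i) (d i) m nb x - S.avP t (κ i) (c i) m nb x)|
    have : ∀ c' : I → X, ∑ q, ∑ x, |∑ i, h q i * ((if c' i = x then 1 else 0)
          - S.avP t (κ i) (c i) m nb x)|
        ≤ ∑ q, ∑ x, |∑ i, h q i * ((if c' i = x then 1 else 0) - pB S κ c d i x)|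
          + (Fintype.card I * (S.LP * l1 (marg (emp κ d)) nb) + R) := by
      intro c'
      refine le_trans ?_ (add_le_add_right (add_le_add_left (T2 d) R) _)
      simp only [R, ← Finset.sum_add_distrib]
      refine Finset.sum_le_sum fun q _ => Finset.sum_le_sum fun x _ => ?_
      have e : ∑ i, h q i * ((if c' i = x then 1 else 0) - S.avP t (κ i) (c i) m nb x)
        = ∑ i, h q i * ((if c' i = x then 1 else 0) - pB S κ c d i x)
         + (∑ i, h q i * (pB S κ c d i x - S.Pk (κ i) (c i) (d i) m nb x)
         + ∑ i, h q i * (S.Pk (κ i) (c i) (d i) m nb x - S.avP t (κ i) (c i) m nb x)) := by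
        rw [← Finset.sum_add_distrib, ← Finset.sum_add_distrib]
        exact Finset.sum_congr rfl fun i _ => by ring
      rw [e]
      exact (abs_add_le _ _).trans (add_le_add_right (abs_add_le _ _) _)
    refine (Finset.sum_le_sum fun c' _ =>
      mul_le_mul_of_nonneg_left (this c') (Wt_nonneg (pB_prob κ c d) c')).trans ?_
    simp_rw [mul_add (Wt _ _), Finset.sum_add_distrib, ← Finset.sum_mul, Wt_sum (pB_prob κ c d)]
    have := T1 d
    linarith
  refine (Finset.sum_le_sum fun d _ =>
      mul_le_mul_of_nonneg_left (main d) (Wt_nonneg (pA_prob κ t c) d)).trans ?_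
  simp_rw [mul_add (Wt _ _), Finset.sum_add_distrib, ← Finset.sum_mul, Wt_sum (pA_prob κ t c)]
  have e2 : ∑ d, Wt (pA S κ t c) d * (Fintype.card I * (S.LP * l1 (marg (emp κ d)) nb)) ≤
      S.LP * Real.sqrt (Fintype.card U) * Z := by
    have h1 := nu_conc (S := S) κ t c
    have e : ∑ d, Wt (pA S κ t c) d * (Fintype.card I * (S.LP * l1 (marg (emp κ d)) nb))
      = Fintype.card I * S.LP * ∑ d, Wt (pA S κ t c) d * l1 (marg (emp κ d)) nb := by
      rw [Finset.mul_sum]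
      exact Finset.sum_congr rfl fun d _ => by ring
    rw [e]
    refine (mul_le_mul_of_nonneg_left h1 (mul_nonneg (Nat.cast_nonneg _) S.hLP)).trans ?_
    have e3 : (Fintype.card I : ℝ) * S.LP * (Real.sqrt (Fintype.card U) *
        (1 / Real.sqrt (Fintype.card I))) = S.LP * Real.sqrt (Fintype.card U) *
          Real.sqrt (Fintype.card I) := by
      have : (Fintype.card I : ℝ) * (1 / Real.sqrt (Fintype.card I)) = Real.sqrt (Fintype.card I) := by
        rw [mul_one_div, Real.div_sqrt]
      calc _ = S.LP * Real.sqrt (Fintype.card U) *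
        ((Fintype.card I : ℝ) * (1 / Real.sqrt (Fintype.card I))) := by ring
        _ = _ := by rw [this]
    rw [e3]
    exact mul_le_mul_of_nonneg_left hcardZ (mul_nonneg S.hLP (Real.sqrt_nonneg _))
  have hX : 1 ≤ Real.sqrt (Fintype.card X) := by
    rw [Real.one_le_sqrt]; exact_mod_cast Fintype.card_pos
  have hU : 1 ≤ Real.sqrt (Fintype.card U) := by
    rw [Real.one_le_sqrt]; exact_mod_cast Fintype.card_pos
  rw [Real.sqrt_mul (Nat.cast_nonneg _)]
  set a := Real.sqrt (Fintype.card X)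
  set b := Real.sqrt (Fintype.card U)
  have h1 : a * Z ≤ a * b * Z := by
    refine mul_le_mul_of_nonneg_right ?_ hZ0
    nlinarith
  have h2 : S.LP * b * Z ≤ S.LP * (a * b) * Z := by
    refine mul_le_mul_of_nonneg_right (mul_le_mul_of_nonneg_left ?_ S.hLP) hZ0
    nlinarith
  linarith

end Emp


section Dyn

set_option linter.unusedSectionVars false
variable {X U : Type*} [Fintype X] [Fintype U] {K : ℕ} {S : MFS X U K}
variable {I : Type*} [Fintype I] [DecidableEq I] [Nonempty I]
variable [DecidableEq X] [DecidableEq U] [Nonempty X] [Nonempty U]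

noncomputable def aJ (κ : I → Fin K) : ℝ :=
  (∑ k, Real.sqrt (∑ i, if κ i = k then 1 else 0)) / (Fintype.card I : ℝ)

lemma l1_joint_form (κ : I → Fin K) (c' : I → X) (μ : X × Fin K → ℝ) (G : I → X → ℝ)
    (hμ : ∀ x k, μ (x, k) = (∑ i, (if κ i = k then 1 else 0) * G i x) / (Fintype.card I : ℝ)) :
    l1 (emp κ c') μ = (∑ k, ∑ x, |∑ i, (if κ i = k then 1 else 0) *
      ((if c' i = x then 1 else 0) - G i x)|) / (Fintype.card I : ℝ) := by
  unfold l1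
  rw [Fintype.sum_prod_type, Finset.sum_comm, Finset.sum_div]
  refine Finset.sum_congr rfl fun k _ => ?_
  rw [Finset.sum_div]
  refine Finset.sum_congr rfl fun x _ => ?_
  rw [hμ]
  unfold emp
  rw [← sub_div, ← Finset.sum_sub_distrib, abs_div, Nat.abs_cast]
  simp_rw [← mul_sub]

lemma l1_marg_form (κ : I → Fin K) (c' : I → X) (μ : X × Fin K → ℝ) (G : I → X → ℝ)
    (hμ : ∀ x k, μ (x, k) = (∑ i, (if κ i = k then 1 else 0) * G i x) / (Fintype.card I : ℝ)) :
    l1 (marg (emp κ c')) (marg μ) = (∑ _k : Unit, ∑ x, |∑ i, 1 *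
      ((if c' i = x then 1 else 0) - G i x)|) / (Fintype.card I : ℝ) := by
  unfold l1
  simp only [Finset.univ_unique, Finset.sum_const, Finset.card_singleton, one_smul, one_mul]
  rw [Finset.sum_div]
  refine Finset.sum_congr rfl fun x _ => ?_
  have : marg μ x = (∑ i, G i x) / (Fintype.card I : ℝ) := by
    unfold marg
    simp_rw [hμ]
    rw [← Finset.sum_div, Finset.sum_comm]
    simp
  rw [this, marg_emp, ← sub_div, ← Finset.sum_sub_distrib, abs_div, Nat.abs_cast]

lemma PM_form (κ : I → Fin K) (t : ℕ) (c : I → X) (x : X) (k : Fin K) :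
    S.PM t (emp κ c) (x, k) = (∑ i, (if κ i = k then 1 else 0) *
      S.avP t (κ i) (c i) (marg (emp κ c)) (marg (S.nuM t (emp κ c))) x) / (Fintype.card I : ℝ) := by
  have := emp_mix κ c k (fun y => S.avP t k y (marg (emp κ c)) (marg (S.nuM t (emp κ c))) x)
  refine this.trans ?_
  congr 1
  refine Finset.sum_congr rfl fun i _ => ?_
  split_ifs with h
  · rw [h]
  · simp

lemma stepJ (κ : I → Fin K) (t : ℕ) (c : I → X) :
    ∑ d, Wt (pA S κ t c) d * ∑ c', Wt (pB S κ c d) c' * l1 (emp κ c') (S.PM t (emp κ c))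
      ≤ (2 + S.LP) * Real.sqrt ((Fintype.card X : ℝ) * Fintype.card U) * aJ κ := by
  have := step_core (S := S) κ t c (fun k i => if κ i = k then 1 else 0)
    (fun k i => by positivity) (fun i => by simp)
  simp_rw [l1_joint_form κ _ _ _ (PM_form (S := S) κ t c), mul_div, ← Finset.sum_div]
  simp_rw [mul_div, ← Finset.sum_div]
  unfold aJ
  rw [mul_div]
  exact div_le_div_of_nonneg_right this (Nat.cast_nonneg _)

lemma stepM (κ : I → Fin K) (t : ℕ) (c : I → X) :
    ∑ d, Wt (pA S κ t c) d * ∑ c', Wt (pB S κ c d) c' *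
        l1 (marg (emp κ c')) (marg (S.PM t (emp κ c)))
      ≤ (2 + S.LP) * Real.sqrt ((Fintype.card X : ℝ) * Fintype.card U) *
        (1 / Real.sqrt (Fintype.card I)) := by
  have := step_core (S := S) κ t c (Q := Unit) (fun k i => 1)
    (fun k i => by positivity) (fun i => by simp)
  rw [← sqrt_div_self', mul_div]
  simp_rw [l1_marg_form κ _ _ _ (PM_form (S := S) κ t c), mul_div, ← Finset.sum_div]
  simp_rw [mul_div, ← Finset.sum_div]
  refine div_le_div_of_nonneg_right (this.trans (le_of_eq ?_)) (Nat.cast_nonneg _)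
  simp

noncomputable def rho (S : MFS X U K) (κ : I → Fin K) (x0 : I → X) : ℕ → (I → X) → ℝ
  | 0 => fun c => if c = x0 then 1 else 0
  | t + 1 => fun c' => ∑ c, ∑ d, rho S κ x0 t c * Wt (pA S κ t c) d * Wt (pB S κ c d) c'

noncomputable def muF (S : MFS X U K) (μ0 : X × Fin K → ℝ) : ℕ → X × Fin K → ℝ
  | 0 => μ0
  | t + 1 => S.PM t (muF S μ0 t)

lemma muF_prob {μ0 : X × Fin K → ℝ} (h : IsProb μ0) (t : ℕ) : IsProb (muF S μ0 t) := by
  induction t with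
  | zero => exact h
  | succ t ih => exact MFS.PM_prob t ih

lemma rho_succ_sum (κ : I → Fin K) (x0 : I → X) (t : ℕ) (f : (I → X) → ℝ) :
    ∑ c', rho S κ x0 (t + 1) c' * f c' =
      ∑ c, rho S κ x0 t c * ∑ d, Wt (pA S κ t c) d * ∑ c', Wt (pB S κ c d) c' * f c' := by
  simp only [rho]
  simp_rw [Finset.sum_mul, Finset.mul_sum]
  rw [Finset.sum_comm]
  refine Finset.sum_congr rfl fun c _ => ?_
  rw [Finset.sum_comm]
  refine Finset.sum_congr rfl fun d _ => Finset.sum_congr rfl fun c' _ => ?_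
  ring

lemma rho_nonneg (κ : I → Fin K) (x0 : I → X) (t : ℕ) (c : I → X) : 0 ≤ rho S κ x0 t c := by
  induction t generalizing c with
  | zero => simp only [rho]; positivity
  | succ t ih =>
    simp only [rho]
    exact Finset.sum_nonneg fun c _ => Finset.sum_nonneg fun d _ => mul_nonneg (mul_nonneg (ih c)
      (Wt_nonneg (pA_prob κ t c) d)) (Wt_nonneg (pB_prob κ c d) _)

lemma rho_sum (κ : I → Fin K) (x0 : I → X) (t : ℕ) : ∑ c, rho S κ x0 t c = 1 := by
  induction t with
  | zero => simp [rho]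
  | succ t ih =>
    have := rho_succ_sum (S := S) κ x0 t (fun _ => 1)
    simp only [mul_one, Wt_sum (pB_prob _ _ _), Wt_sum (pA_prob _ _ _), ih] at this
    exact this

noncomputable def eJ (S : MFS X U K) (κ : I → Fin K) (x0 : I → X) (t : ℕ) : ℝ :=
  ∑ c, rho S κ x0 t c * l1 (emp κ c) (muF S (emp κ x0) t)

noncomputable def eM (S : MFS X U K) (κ : I → Fin K) (x0 : I → X) (t : ℕ) : ℝ :=
  ∑ c, rho S κ x0 t c * l1 (marg (emp κ c)) (marg (muF S (emp κ x0) t))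

lemma eJ_zero (κ : I → Fin K) (x0 : I → X) : eJ S κ x0 0 = 0 := by
  simp [eJ, rho, muF, l1_self]

lemma eM_zero (κ : I → Fin K) (x0 : I → X) : eM S κ x0 0 = 0 := by
  simp [eM, rho, muF, l1_self]

lemma rec_aux (κ : I → Fin K) (x0 : I → X) (t : ℕ) (f : (I → X) → ℝ) (g : (I → X) → (I → X) → ℝ)
    (D : ℝ) (hg : ∀ c, ∑ d, Wt (pA S κ t c) d * ∑ c', Wt (pB S κ c d) c' * g c c' ≤ D)
    (hf : ∀ c c', f c' ≤ g c c' + (S.SP1 * l1 (emp κ c) (muF S (emp κ x0) t) +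
      S.SP2 * l1 (marg (emp κ c)) (marg (muF S (emp κ x0) t)))) :
    ∑ c', rho S κ x0 (t + 1) c' * f c' ≤ D + S.SP1 * eJ S κ x0 t + S.SP2 * eM S κ x0 t := by
  rw [rho_succ_sum]
  have key : ∀ c, ∑ d, Wt (pA S κ t c) d * ∑ c', Wt (pB S κ c d) c' * f c' ≤
     D + (S.SP1 * l1 (emp κ c) (muF S (emp κ x0) t) +
      S.SP2 * l1 (marg (emp κ c)) (marg (muF S (emp κ x0) t))) := by
    intro c
    set R := S.SP1 * l1 (emp κ c) (muF S (emp κ x0) t) +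
      S.SP2 * l1 (marg (emp κ c)) (marg (muF S (emp κ x0) t))
    have h1 : ∀ d, ∑ c', Wt (pB S κ c d) c' * f c' ≤ ∑ c', Wt (pB S κ c d) c' * g c c' + R := by
      intro d
      refine (Finset.sum_le_sum fun c' _ => mul_le_mul_of_nonneg_left (hf c c')
        (Wt_nonneg (pB_prob κ c d) c')).trans (le_of_eq ?_)
      simp_rw [mul_add (Wt _ _), Finset.sum_add_distrib, ← Finset.sum_mul, Wt_sum (pB_prob κ c d)]
      simp only [one_mul, R]
    refine (Finset.sum_le_sum fun d _ => mul_le_mul_of_nonneg_left (h1 d)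
        (Wt_nonneg (pA_prob κ t c) d)).trans ?_
    simp_rw [mul_add (Wt _ _), Finset.sum_add_distrib, ← Finset.sum_mul, Wt_sum (pA_prob κ t c)]
    rw [one_mul]
    linarith [hg c]
  refine (Finset.sum_le_sum fun c _ => mul_le_mul_of_nonneg_left (key c)
        (rho_nonneg κ x0 t c)).trans (le_of_eq ?_)
  simp_rw [mul_add (rho _ _ _ _ _), Finset.sum_add_distrib, ← Finset.sum_mul, rho_sum]
  unfold eJ eM
  rw [Finset.mul_sum, Finset.mul_sum, one_mul, add_assoc]
  congr 2 <;> exact Finset.sum_congr rfl fun d _ => by ring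

lemma recJ (κ : I → Fin K) (x0 : I → X) (t : ℕ) : eJ S κ x0 (t + 1) ≤
    (2 + S.LP) * Real.sqrt ((Fintype.card X : ℝ) * Fintype.card U) * aJ κ
      + S.SP1 * eJ S κ x0 t + S.SP2 * eM S κ x0 t := by
  refine rec_aux κ x0 t _ (fun c c' => l1 (emp κ c') (S.PM t (emp κ c))) _ (stepJ κ t) ?_
  intro c c'
  exact (l1_tri _ (S.PM t (emp κ c)) _).trans
    (add_le_add_right (MFS.PM_lip t (emp_prob κ c) (muF_prob (emp_prob κ x0) t)) _)

lemma recM (κ : I → Fin K) (x0 : I → X) (t : ℕ) : eM S κ x0 (t + 1) ≤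
    (2 + S.LP) * Real.sqrt ((Fintype.card X : ℝ) * Fintype.card U) *
      (1 / Real.sqrt (Fintype.card I))
      + S.SP1 * eJ S κ x0 t + S.SP2 * eM S κ x0 t := by
  refine rec_aux κ x0 t _ (fun c c' => l1 (marg (emp κ c')) (marg (S.PM t (emp κ c)))) _
    (stepM κ t) ?_
  intro c c'
  exact (l1_tri _ (marg (S.PM t (emp κ c))) _).trans
    (add_le_add_right ((l1_marg _ _).trans
      (MFS.PM_lip t (emp_prob κ c) (muF_prob (emp_prob κ x0) t))) _)

noncomputable def RN (S : MFS X U K) (κ : I → Fin K) (c : I → X) (d : I → U) : ℝ :=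
  (∑ i, S.r (κ i) (c i) (d i) (marg (emp κ c)) (marg (emp κ d))) / (Fintype.card I : ℝ)

lemma reward_cond (κ : I → Fin K) (t : ℕ) (c : I → X) :
    |∑ d, Wt (pA S κ t c) d * RN S κ c d - S.rM t (emp κ c)| ≤
      S.LR * (Real.sqrt (Fintype.card U) * (1 / Real.sqrt (Fintype.card I))) := by
  set m := marg (emp κ c) with hm
  set nb := marg (S.nuM t (emp κ c)) with hnb
  have pm : IsProb m := (emp_prob κ c).marg
  have pn : IsProb nb := (MFS.nuM_prob t (emp_prob κ c)).marg
  have e : S.rM t (emp κ c) = ∑ d, Wt (pA S κ t c) d *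
      ((∑ i, S.r (κ i) (c i) (d i) m nb) / (Fintype.card I : ℝ)) := by
    have h1 := emp_mix_marg κ c (fun k x => S.avr t k x m nb)
    refine h1.trans ?_
    simp_rw [mul_div, ← Finset.sum_div, Finset.mul_sum]
    rw [Finset.sum_comm]
    congr 1
    refine Finset.sum_congr rfl fun i _ => ?_
    exact (Wt_single (pA_prob κ t c) i (fun u => S.r (κ i) (c i) u m nb)).symm
  rw [e, ← Finset.sum_sub_distrib]
  refine (Finset.abs_sum_le_sum_abs _ _).trans ?_
  refine le_trans ?_ (mul_le_mul_of_nonneg_left (nu_conc (S := S) κ t c) S.hLR)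
  rw [Finset.mul_sum]
  refine Finset.sum_le_sum fun d _ => ?_
  rw [← mul_sub, abs_mul, abs_of_nonneg (Wt_nonneg (pA_prob κ t c) d), mul_left_comm]
  refine mul_le_mul_of_nonneg_left ?_ (Wt_nonneg (pA_prob κ t c) d)
  unfold RN
  rw [← sub_div, ← Finset.sum_sub_distrib, abs_div, Nat.abs_cast, div_le_iff₀ card_pos']
  refine (Finset.abs_sum_le_sum_abs _ _).trans ?_
  refine (Finset.sum_le_sum (g := fun _ => S.LR * l1 (marg (emp κ d)) nb) fun i _ => ?_).trans
    (le_of_eq ?_)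
  · have := S.hrLip (κ i) (c i) (d i) m (marg (emp κ d)) m nb pm (emp_prob κ d).marg pm pn
    rwa [l1_self, zero_add] at this
  · simp [mul_comm, hnb]

lemma reward_err (κ : I → Fin K) (x0 : I → X) (t : ℕ) :
    |∑ c, rho S κ x0 t c * ∑ d, Wt (pA S κ t c) d * RN S κ c d - S.rM t (muF S (emp κ x0) t)| ≤
      S.LR * (Real.sqrt (Fintype.card U) * (1 / Real.sqrt (Fintype.card I)))
      + S.SR1 * eJ S κ x0 t + S.SR2 * eM S κ x0 t := by
  have e : S.rM t (muF S (emp κ x0) t) = ∑ c, rho S κ x0 t c * S.rM t (muF S (emp κ x0) t) := by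
    rw [← Finset.sum_mul, rho_sum, one_mul]
  rw [e, ← Finset.sum_sub_distrib]
  refine (Finset.abs_sum_le_sum_abs _ _).trans ?_
  refine (Finset.sum_le_sum (g := fun c => rho S κ x0 t c *
      (S.LR * (Real.sqrt (Fintype.card U) * (1 / Real.sqrt (Fintype.card I))) +
      (S.SR1 * l1 (emp κ c) (muF S (emp κ x0) t) +
      S.SR2 * l1 (marg (emp κ c)) (marg (muF S (emp κ x0) t))))) fun c _ => ?_).trans (le_of_eq ?_)
  · rw [← mul_sub, abs_mul, abs_of_nonneg (rho_nonneg κ x0 t c)]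
    refine mul_le_mul_of_nonneg_left ?_ (rho_nonneg κ x0 t c)
    exact (abs_sub_le _ (S.rM t (emp κ c)) _).trans (add_le_add (reward_cond κ t c)
      (MFS.rM_lip t (emp_prob κ c) (muF_prob (emp_prob κ x0) t)))
  · simp_rw [mul_add (rho _ _ _ _ _), Finset.sum_add_distrib, ← Finset.sum_mul, rho_sum]
    unfold eJ eM
    rw [Finset.mul_sum, Finset.mul_sum, one_mul, add_assoc]
    congr 2 <;> exact Finset.sum_congr rfl fun d _ => by ring

/-! The degenerate case: decoupled agents. -/

noncomputable def pS (S : MFS X U K) (κ : I → Fin K) (x0 : I → X) (m : X → ℝ) (n : U → ℝ) :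
    ℕ → I → X → ℝ
  | 0 => fun i x => if x = x0 i then 1 else 0
  | t + 1 => fun i x' => ∑ x, pS S κ x0 m n t i x * S.avP t (κ i) x m n x'

lemma pS_prob (κ : I → Fin K) (x0 : I → X) {m : X → ℝ} {n : U → ℝ} (hm : IsProb m)
    (hn : IsProb n) (t : ℕ) (i : I) : IsProb (pS S κ x0 m n t i) := by
  induction t with
  | zero => exact ⟨fun x => by simp only [pS]; positivity, by simp [pS]⟩
  | succ t ih =>
    refine ⟨fun x => Finset.sum_nonneg fun y _ => mul_nonneg (ih.1 y)
      ((MFS.avP_prob t (κ i) y hm hn).1 x), ?_⟩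
    simp only [pS]
    rw [Finset.sum_comm]
    simp_rw [← Finset.mul_sum, (MFS.avP_prob t (κ i) _ hm hn).2, mul_one]
    exact ih.2

lemma l1_eq_zero {A : Type*} [Fintype A] {m n : A → ℝ} (h : l1 m n ≤ 0) : m = n := by
  have h0 : l1 m n = 0 := le_antisymm h (l1_nonneg m n)
  funext a
  have := (Finset.sum_eq_zero_iff_of_nonneg (fun a _ => abs_nonneg (m a - n a))).1 h0 a
    (Finset.mem_univ a)
  exact sub_eq_zero.1 (abs_eq_zero.1 this)

lemma pi_indep (hQ : S.LQ = 0) (t k x) {m m' : X → ℝ} (hm : IsProb m) (hm' : IsProb m') :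
    S.pi t k x m = S.pi t k x m' :=
  l1_eq_zero (by simpa [hQ] using S.hpiLip t k x m m' hm hm')

lemma Pk_indep (hP : S.LP = 0) (k x u) {m m' : X → ℝ} {n n' : U → ℝ} (hm : IsProb m)
    (hm' : IsProb m') (hn : IsProb n) (hn' : IsProb n') :
    S.Pk k x u m n = S.Pk k x u m' n' :=
  l1_eq_zero (by simpa [hP] using S.hPkLip k x u m n m' n' hm hn hm' hn')

lemma rho_prod (hP : S.LP = 0) (hQ : S.LQ = 0) (κ : I → Fin K) (x0 : I → X) {m : X → ℝ} {n : U → ℝ}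
    (hm : IsProb m) (hn : IsProb n) (t : ℕ) (c : I → X) :
    rho S κ x0 t c = Wt (pS S κ x0 m n t) c := by
  induction t generalizing c with
  | zero =>
    simp only [rho, Wt, pS]
    rw [Finset.prod_ite_zero]
    simp [funext_iff]
  | succ t ih =>
    simp only [rho]
    have h1 : ∀ c₁ : I → X, ∀ d : I → U, rho S κ x0 t c₁ * Wt (pA S κ t c₁) d * Wt (pB S κ c₁ d) c =
        ∏ i, (pS S κ x0 m n t i (c₁ i) * S.pi t (κ i) (c₁ i) m (d i) *
          S.Pk (κ i) (c₁ i) (d i) m n (c i)) := by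
      intro c₁ d
      rw [ih, Finset.prod_mul_distrib, Finset.prod_mul_distrib]
      unfold Wt pA pB
      congr 1
      · congr 1
        exact Finset.prod_congr rfl fun i _ => by rw [pi_indep hQ _ _ _ (emp_prob κ c₁).marg hm]
      · exact Finset.prod_congr rfl fun i _ => by
          rw [Pk_indep hP _ _ _ (emp_prob κ c₁).marg hm (emp_prob κ d).marg hn]
    simp_rw [h1]
    have h2 : ∀ c₁ : I → X, ∑ d : I → U, ∏ i, (pS S κ x0 m n t i (c₁ i) * 
          S.pi t (κ i) (c₁ i) m (d i) * S.Pk (κ i) (c₁ i) (d i) m n (c i)) =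
        ∏ i, ∑ u, (pS S κ x0 m n t i (c₁ i) * 
          S.pi t (κ i) (c₁ i) m u * S.Pk (κ i) (c₁ i) u m n (c i)) := fun c₁ =>
      sum_prod_fun (fun i u => pS S κ x0 m n t i (c₁ i) * 
          S.pi t (κ i) (c₁ i) m u * S.Pk (κ i) (c₁ i) u m n (c i))
    simp_rw [h2]
    rw [sum_prod_fun (fun i x => ∑ u, pS S κ x0 m n t i x * 
          S.pi t (κ i) x m u * S.Pk (κ i) x u m n (c i))]
    unfold Wt
    refine Finset.prod_congr rfl fun i _ => ?_
    simp only [pS, MFS.avP]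
    refine Finset.sum_congr rfl fun x _ => ?_
    rw [Finset.mul_sum]
    exact Finset.sum_congr rfl fun u _ => by ring

lemma muF_prod (hP : S.LP = 0) (hQ : S.LQ = 0) (κ : I → Fin K) (x0 : I → X) {m : X → ℝ} {n : U → ℝ}
    (hm : IsProb m) (hn : IsProb n) (t : ℕ) (x : X) (k : Fin K) :
    muF S (emp κ x0) t (x, k) = (∑ i, (if κ i = k then 1 else 0) * pS S κ x0 m n t i x)
      / (Fintype.card I : ℝ) := by
  induction t generalizing x with
  | zero =>
    simp only [muF, pS, emp]
    simp_rw [eq_comm]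
  | succ t ih =>
    have hμ := muF_prob (S := S) (emp_prob κ x0) t
    have hν := MFS.nuM_prob (S := S) t hμ
    have h1 : ∀ y, S.avP t k y (marg (muF S (emp κ x0) t)) (marg (S.nuM t (muF S (emp κ x0) t))) x
        = S.avP t k y m n x := by
      intro y
      unfold MFS.avP
      refine Finset.sum_congr rfl fun u _ => ?_
      rw [pi_indep hQ t k y hμ.marg hm, Pk_indep hP k y u hμ.marg hm hν.marg hn]
    simp only [muF, MFS.PM, h1, ih, pS]
    simp_rw [div_mul_eq_mul_div, ← Finset.sum_div, Finset.sum_mul]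
    rw [Finset.sum_comm]
    congr 1
    refine Finset.sum_congr rfl fun i _ => ?_
    rw [Finset.mul_sum]
    refine Finset.sum_congr rfl fun y _ => ?_
    split_ifs with h
    · rw [h, mul_assoc]
    · simp

lemma eJ_deg (hP : S.LP = 0) (hQ : S.LQ = 0) (κ : I → Fin K) (x0 : I → X) (t : ℕ) :
    eJ S κ x0 t ≤ Real.sqrt (Fintype.card X) * aJ κ := by
  have hm := (emp_prob κ x0).marg
  have hn := (MFS.nuM_prob (S := S) 0 (emp_prob κ x0)).marg
  have := concInd (pS_prob (S := S) κ x0 hm hn t) (fun k i => if κ i = k then 1 else 0)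
    (fun k i => by positivity) (fun k i => by split_ifs <;> simp)
  unfold eJ
  simp_rw [l1_joint_form κ _ _ _ (muF_prod hP hQ κ x0 hm hn t), rho_prod hP hQ κ x0 hm hn,
    mul_div, ← Finset.sum_div]
  unfold aJ
  rw [mul_div]
  exact div_le_div_of_nonneg_right this (Nat.cast_nonneg _)

lemma eM_deg (hP : S.LP = 0) (hQ : S.LQ = 0) (κ : I → Fin K) (x0 : I → X) (t : ℕ) :
    eM S κ x0 t ≤ Real.sqrt (Fintype.card X) * (1 / Real.sqrt (Fintype.card I)) := by
  have hm := (emp_prob κ x0).marg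
  have hn := (MFS.nuM_prob (S := S) 0 (emp_prob κ x0)).marg
  have := concInd (pS_prob (S := S) κ x0 hm hn t) (Q := Unit) (fun k i => 1)
    (fun k i => by positivity) (fun k i => le_refl _)
  unfold eM
  rw [← sqrt_div_self', mul_div]
  simp_rw [l1_marg_form κ _ _ _ (muF_prod hP hQ κ x0 hm hn t), rho_prod hP hQ κ x0 hm hn,
    mul_div, ← Finset.sum_div]
  refine div_le_div_of_nonneg_right (this.trans (le_of_eq ?_)) (Nat.cast_nonneg _)
  simp

end Dyn


section Series

lemma series_bound (γ : ℝ) (hγ0 : 0 ≤ γ) (hγ1 : γ < 1) (q : ℝ) (hq0 : 0 ≤ q) (hq : γ * q < 1)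
    (E0 G H : ℝ) (err : ℕ → ℝ) (h0 : |err 0| ≤ E0)
    (hs : ∀ t, |err (t + 1)| ≤ E0 + G + H * (q ^ t - 1)) :
    |∑' t, γ ^ t * err t| ≤ E0 / (1 - γ) + γ / (1 - γ) * G + H * (γ / (1 - γ * q) - γ / (1 - γ)) := by
  have g1 : HasSum (fun t : ℕ => γ ^ t) (1 - γ)⁻¹ := hasSum_geometric_of_lt_one hγ0 hγ1
  have g2 : HasSum (fun t : ℕ => (γ * q) ^ t) (1 - γ * q)⁻¹ :=
    hasSum_geometric_of_lt_one (mul_nonneg hγ0 hq0) hq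
  let f : ℕ → ℝ := fun t => match t with
    | 0 => E0
    | t + 1 => γ ^ (t + 1) * (E0 + G + H * (q ^ t - 1))
  have hf' : HasSum (fun t => f (t + 1)) (γ * (E0 + G - H) * (1 - γ)⁻¹ + γ * H * (1 - γ * q)⁻¹) := by
    have h3 := (g1.mul_left (γ * (E0 + G - H))).add (g2.mul_left (γ * H))
    have e : (fun t => f (t + 1)) = fun t => γ * (E0 + G - H) * γ ^ t + γ * H * (γ * q) ^ t := by
      funext t
      simp only [f, mul_pow]
      ring
    rw [e]
    exact h3
  have hf : HasSum f (f 0 + (γ * (E0 + G - H) * (1 - γ)⁻¹ + γ * H * (1 - γ * q)⁻¹)) := by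
    have := (hasSum_nat_add_iff (f := f) 1).1 hf'
    rw [add_comm]
    simpa using this
  have hb : ∀ t, ‖γ ^ t * err t‖ ≤ f t := by
    intro t
    rw [Real.norm_eq_abs, abs_mul, abs_of_nonneg (pow_nonneg hγ0 t)]
    cases t with
    | zero => simpa [f] using h0
    | succ t => exact mul_le_mul_of_nonneg_left (hs t) (pow_nonneg hγ0 _)
  have := tsum_of_norm_bounded hf hb
  rw [Real.norm_eq_abs] at this
  refine this.trans (le_of_eq ?_)
  have h1 : 1 - γ ≠ 0 := by linarith
  have h2 : 1 - γ * q ≠ 0 := by linarith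
  simp only [f]
  field_simp
  ring

end Series

section Law

set_option linter.unusedSectionVars false

lemma total_prob {Ω : Type*} [MeasurableSpace Ω] (P : Measure Ω) [IsProbabilityMeasure P]
    {β : Type*} [Fintype β] (f : Ω → β) (hf : ∀ b, MeasurableSet (f ⁻¹' {b})) (E : Set Ω) :
    P.real E = ∑ b, P.real (E ∩ f ⁻¹' {b}) := by
  have h := sum_measure_preimage_singleton (μ := P.restrict E) Finset.univ (f := f) (fun y _ => hf y)
  simp only [Finset.coe_univ, Set.preimage_univ, Measure.restrict_apply_univ] at h
  unfold Measure.real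
  rw [← h, ENNReal.toReal_sum (fun b _ => measure_ne_top _ _)]
  refine Finset.sum_congr rfl fun b _ => ?_
  rw [Measure.restrict_apply (hf b), Set.inter_comm]

lemma integral_fin {Ω : Type*} [MeasurableSpace Ω] (P : Measure Ω) [IsProbabilityMeasure P]
    {β : Type*} [Fintype β] (Z : Ω → β) (hZ : ∀ b, MeasurableSet (Z ⁻¹' {b})) (f : β → ℝ) :
    Integrable (fun ω => f (Z ω)) P ∧ ∫ ω, f (Z ω) ∂P = ∑ b, P.real (Z ⁻¹' {b}) * f b := by
  classical
  have e : (fun ω => f (Z ω)) = fun ω => ∑ b, (Z ⁻¹' {b}).indicator (fun _ => f b) ω := by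
    funext ω
    simp [Set.indicator_apply]
  have hi : ∀ b ∈ (Finset.univ : Finset β), Integrable ((Z ⁻¹' {b}).indicator (fun _ => f b)) P :=
    fun b _ => (integrable_const (f b)).indicator (hZ b)
  rw [e]
  refine ⟨integrable_finsetSum _ hi, ?_⟩
  rw [integral_finsetSum _ hi]
  refine Finset.sum_congr rfl fun b _ => ?_
  rw [integral_indicator_const _ (hZ b), smul_eq_mul]

variable {Ω : Type*} [MeasurableSpace Ω] (P : Measure Ω) [IsProbabilityMeasure P]
  {C D : Type*} [Fintype C] [Fintype D] [DecidableEq C] [DecidableEq D]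

lemma law_step (x : ℕ → Ω → C) (u : ℕ → Ω → D) (hx : ∀ t c, MeasurableSet (x t ⁻¹' {c}))
    (hu : ∀ t c, MeasurableSet (u t ⁻¹' {c})) (x0 : C) (hx0 : ∀ ω, x 0 ω = x0)
    (A : ℕ → C → D → ℝ) (B : C → D → C → ℝ) (hA : ∀ t c d, 0 ≤ A t c d) (hB : ∀ c d c', 0 ≤ B c d c')
    (hlaw : ∀ (T : ℕ) (Xs : ℕ → C) (Us : ℕ → D), Xs 0 = x0 →
      P {ω | ∀ t ≤ T, x t ω = Xs t ∧ u t ω = Us t} = ENNReal.ofReal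
        ((∏ t ∈ Finset.range (T + 1), A t (Xs t) (Us t)) *
          ∏ t ∈ Finset.range T, B (Xs t) (Us t) (Xs (t + 1)))) (T : ℕ) (c' : C) (d' : D) :
    P.real {ω | x (T + 1) ω = c' ∧ u (T + 1) ω = d'} =
      ∑ c, ∑ d, P.real {ω | x T ω = c ∧ u T ω = d} * B c d c' * A (T + 1) c' d' := by
  let H : Ω → (Fin (T + 1) → C × D) := fun ω s => (x s ω, u s ω)
  have hH : ∀ h, MeasurableSet (H ⁻¹' {h}) := by
    intro h
    have : H ⁻¹' {h} = ⋂ s : Fin (T + 1), (x s ⁻¹' {(h s).1} ∩ u s ⁻¹' {(h s).2}) := by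
      ext ω
      simp [H, funext_iff, Prod.ext_iff]
    rw [this]
    exact MeasurableSet.iInter fun s => (hx _ _).inter (hu _ _)
  -- one-step extension
  have step : ∀ h : Fin (T + 1) → C × D,
      P.real ({ω | x (T + 1) ω = c' ∧ u (T + 1) ω = d'} ∩ H ⁻¹' {h}) =
        P.real (H ⁻¹' {h}) * B (h (Fin.last T)).1 (h (Fin.last T)).2 c' * A (T + 1) c' d' := by
    intro h
    by_cases h0 : (h 0).1 = x0
    · let Xs : ℕ → C := fun t => if ht : t < T + 1 then (h ⟨t, ht⟩).1 else c'
      let Us : ℕ → D := fun t => if ht : t < T + 1 then (h ⟨t, ht⟩).2 else d'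
      have hX0 : Xs 0 = x0 := by simpa [Xs] using h0
      have e1 : H ⁻¹' {h} = {ω | ∀ t ≤ T, x t ω = Xs t ∧ u t ω = Us t} := by
        ext ω
        simp only [Set.mem_preimage, Set.mem_singleton_iff, H, funext_iff, Prod.ext_iff,
          Set.mem_ofPred_eq, Xs, Us]
        constructor
        · intro hh t ht
          have := hh ⟨t, Nat.lt_succ_of_le ht⟩
          simpa [Nat.lt_succ_of_le ht] using this
        · intro hh s
          have := hh s (Nat.le_of_lt_succ s.2)
          simpa [Nat.le_of_lt_succ s.2] using this
      have e2 : {ω | x (T + 1) ω = c' ∧ u (T + 1) ω = d'} ∩ H ⁻¹' {h} =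
          {ω | ∀ t ≤ T + 1, x t ω = Xs t ∧ u t ω = Us t} := by
        rw [e1]
        ext ω
        have hXT : Xs (T + 1) = c' := by simp [Xs]
        have hUT : Us (T + 1) = d' := by simp [Us]
        simp only [Set.mem_inter_iff, Set.mem_ofPred_eq]
        constructor
        · rintro ⟨a, b⟩ t ht
          rcases Nat.le_succ_iff.1 ht with h | h
          · exact b t h
          · subst h; rw [Nat.succ_eq_add_one, hXT, hUT]; exact a
        · intro a
          refine ⟨?_, fun t ht => a t (Nat.le_succ_of_le ht)⟩
          have := a (T + 1) le_rfl
          rwa [hXT, hUT] at this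
      rw [e2, e1]
      unfold Measure.real
      rw [hlaw _ Xs Us hX0, hlaw _ Xs Us hX0, ENNReal.toReal_ofReal, ENNReal.toReal_ofReal,
        Finset.prod_range_succ _ (T + 1), Finset.prod_range_succ (fun t => B _ _ _) T]
      · have hXT : Xs (T + 1) = c' := by simp [Xs]
        have hUT : Us (T + 1) = d' := by simp [Us]
        have hX1 : Xs T = (h (Fin.last T)).1 := by simp [Xs]; rfl
        have hU1 : Us T = (h (Fin.last T)).2 := by simp [Us]; rfl
        rw [hXT, hUT, hX1, hU1]
        ring
      · exact mul_nonneg (Finset.prod_nonneg fun _ _ => hA _ _ _) (Finset.prod_nonneg fun _ _ => hB _ _ _)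
      · exact mul_nonneg (Finset.prod_nonneg fun _ _ => hA _ _ _) (Finset.prod_nonneg fun _ _ => hB _ _ _)
    · have e : H ⁻¹' {h} = ∅ := by
        ext ω
        simp only [Set.mem_preimage, Set.mem_singleton_iff, Set.mem_empty_iff_false, iff_false]
        intro hh
        apply h0
        rw [← hh, ← hx0 ω]
        simp [H]
      simp [e]
  rw [total_prob P H hH]
  simp_rw [step]
  have last : ∀ c d, P.real {ω | x T ω = c ∧ u T ω = d} =
      ∑ h, if h (Fin.last T) = (c, d) then P.real (H ⁻¹' {h}) else 0 := by
    intro c d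
    rw [total_prob P H hH]
    refine Finset.sum_congr rfl fun h _ => ?_
    split_ifs with hh
    · congr 1
      ext ω
      simp only [Set.mem_inter_iff, Set.mem_ofPred_eq, Set.mem_preimage, Set.mem_singleton_iff,
        and_iff_right_iff_imp]
      intro e
      rw [← e] at hh
      simpa [H] using hh
    · have : {ω | x T ω = c ∧ u T ω = d} ∩ H ⁻¹' {h} = ∅ := by
        ext ω
        simp only [Set.mem_inter_iff, Set.mem_ofPred_eq, Set.mem_preimage, Set.mem_singleton_iff,
          Set.mem_empty_iff_false, iff_false, not_and]
        intro a e
        apply hh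
        rw [← e]
        simp [H, a]
      rw [this]; simp
  simp_rw [last, Finset.sum_mul]
  rw [← Fintype.sum_prod_type' (f := fun c d => ∑ h : Fin (T + 1) → C × D,
    (if h (Fin.last T) = (c, d) then P.real (H ⁻¹' {h}) else 0) * B c d c' * A (T + 1) c' d'),
    Finset.sum_comm]
  refine Finset.sum_congr rfl fun h _ => ?_
  rw [Finset.sum_eq_single (h (Fin.last T))]
  · simp
  · intro b _ hb
    rw [if_neg (fun e => hb (by rw [e]))]
    simp
  · simp

lemma law_zero (x : ℕ → Ω → C) (u : ℕ → Ω → D) (x0 : C) (hx0 : ∀ ω, x 0 ω = x0)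
    (A : ℕ → C → D → ℝ) (B : C → D → C → ℝ) (hA : ∀ t c d, 0 ≤ A t c d)
    (hlaw : ∀ (T : ℕ) (Xs : ℕ → C) (Us : ℕ → D), Xs 0 = x0 →
      P {ω | ∀ t ≤ T, x t ω = Xs t ∧ u t ω = Us t} = ENNReal.ofReal
        ((∏ t ∈ Finset.range (T + 1), A t (Xs t) (Us t)) *
          ∏ t ∈ Finset.range T, B (Xs t) (Us t) (Xs (t + 1)))) (c : C) (d : D) :
    P.real {ω | x 0 ω = c ∧ u 0 ω = d} = (if c = x0 then 1 else 0) * A 0 c d := by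
  split_ifs with h
  · have := hlaw 0 (fun _ => c) (fun _ => d) h
    simp only [Nat.le_zero, forall_eq, zero_add, Finset.range_one, Finset.prod_singleton,
      Finset.range_zero, Finset.prod_empty, mul_one] at this
    unfold Measure.real
    rw [this, ENNReal.toReal_ofReal (hA _ _ _), one_mul]
  · have : {ω | x 0 ω = c ∧ u 0 ω = d} = ∅ := by
      ext ω
      simp only [Set.mem_ofPred_eq, Set.mem_empty_iff_false, iff_false, not_and]
      intro e
      exact absurd (e.symm.trans (hx0 ω)) h
    rw [this]; simp

end Law


section CoreI

variable {Ω : Type*} [MeasurableSpace Ω] (P : Measure Ω) [IsProbabilityMeasure P]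
variable {X U : Type*} [Fintype X] [Fintype U] {K : ℕ} (S : MFS X U K)
variable {I : Type*} [Fintype I] [DecidableEq I] [Nonempty I]
variable [DecidableEq X] [DecidableEq U] [Nonempty X] [Nonempty U]

lemma law_J (κ : I → Fin K) (x0 : I → X) (x : ℕ → Ω → I → X) (u : ℕ → Ω → I → U)
    (hx : ∀ t c, MeasurableSet (x t ⁻¹' {c})) (hu : ∀ t c, MeasurableSet (u t ⁻¹' {c}))
    (hx0 : ∀ ω, x 0 ω = x0)
    (hlaw : ∀ (T : ℕ) (Xs : ℕ → I → X) (Us : ℕ → I → U), Xs 0 = x0 →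
      P {ω | ∀ t ≤ T, x t ω = Xs t ∧ u t ω = Us t} = ENNReal.ofReal
        ((∏ t ∈ Finset.range (T + 1), Wt (pA S κ t (Xs t)) (Us t)) *
          ∏ t ∈ Finset.range T, Wt (pB S κ (Xs t) (Us t)) (Xs (t + 1)))) (t : ℕ)
    (c : I → X) (d : I → U) :
    P.real {ω | x t ω = c ∧ u t ω = d} = rho S κ x0 t c * Wt (pA S κ t c) d := by
  induction t generalizing c d with
  | zero =>
    rw [law_zero P x u x0 hx0 (fun t c d => Wt (pA S κ t c) d) (fun c d c' => Wt (pB S κ c d) c')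
      (fun t c d => Wt_nonneg (pA_prob κ t c) d) hlaw]
    rfl
  | succ t ih =>
    rw [law_step P x u hx hu x0 hx0 (fun t c d => Wt (pA S κ t c) d)
      (fun c d c' => Wt (pB S κ c d) c')
      (fun t c d => Wt_nonneg (pA_prob κ t c) d) (fun c d c' => Wt_nonneg (pB_prob κ c d) c') hlaw]
    simp_rw [ih, ← Finset.sum_mul]
    rfl

lemma vN_hasSum (κ : I → Fin K) (x0 : I → X) (x : ℕ → Ω → I → X) (u : ℕ → Ω → I → U)
    (hx : ∀ t c, MeasurableSet (x t ⁻¹' {c})) (hu : ∀ t c, MeasurableSet (u t ⁻¹' {c}))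
    (hx0 : ∀ ω, x 0 ω = x0)
    (hlaw : ∀ (T : ℕ) (Xs : ℕ → I → X) (Us : ℕ → I → U), Xs 0 = x0 →
      P {ω | ∀ t ≤ T, x t ω = Xs t ∧ u t ω = Us t} = ENNReal.ofReal
        ((∏ t ∈ Finset.range (T + 1), Wt (pA S κ t (Xs t)) (Us t)) *
          ∏ t ∈ Finset.range T, Wt (pB S κ (Xs t) (Us t)) (Xs (t + 1))))
    (γ : ℝ) (hγ0 : 0 ≤ γ) (hγ1 : γ < 1) :
    HasSum (fun t => γ ^ t * ∑ c, rho S κ x0 t c * ∑ d, Wt (pA S κ t c) d * RN S κ c d)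
      ((∑ i, ∫ ω, ∑' t : ℕ, γ ^ t * S.r (κ i) (x t ω i) (u t ω i) (marg (emp κ (x t ω)))
        (marg (emp κ (u t ω))) ∂P) / (Fintype.card I : ℝ)) := by
  have hZ : ∀ t (b : (I → X) × (I → U)), MeasurableSet ((fun ω => (x t ω, u t ω)) ⁻¹' {b}) := by
    intro t b
    have : (fun ω => (x t ω, u t ω)) ⁻¹' {b} = x t ⁻¹' {b.1} ∩ u t ⁻¹' {b.2} := by
      ext ω; simp [Prod.ext_iff]
    rw [this]
    exact (hx _ _).inter (hu _ _)
  have hJ : ∀ t (b : (I → X) × (I → U)), P.real ((fun ω => (x t ω, u t ω)) ⁻¹' {b}) =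
      rho S κ x0 t b.1 * Wt (pA S κ t b.1) b.2 := by
    intro t b
    rw [← law_J P S κ x0 x u hx hu hx0 hlaw]
    congr 1
    ext ω; simp [Prod.ext_iff]
  have hint : ∀ i t, Integrable (fun ω => γ ^ t * S.r (κ i) (x t ω i) (u t ω i)
        (marg (emp κ (x t ω))) (marg (emp κ (u t ω)))) P := fun i t =>
    ((integral_fin P (fun ω => (x t ω, u t ω)) (hZ t) (fun b => S.r (κ i) (b.1 i) (b.2 i)
        (marg (emp κ b.1)) (marg (emp κ b.2)))).1).const_mul (γ ^ t)
  have hval : ∀ i t, ∫ ω, γ ^ t * S.r (κ i) (x t ω i) (u t ω i)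
        (marg (emp κ (x t ω))) (marg (emp κ (u t ω))) ∂P = γ ^ t * ∑ c, rho S κ x0 t c * ∑ d,
          Wt (pA S κ t c) d * S.r (κ i) (c i) (d i) (marg (emp κ c)) (marg (emp κ d)) := by
    intro i t
    rw [integral_const_mul]
    congr 1
    refine (integral_fin P (fun ω => (x t ω, u t ω)) (hZ t) (fun b => S.r (κ i) (b.1 i) (b.2 i)
        (marg (emp κ b.1)) (marg (emp κ b.2)))).2.trans ?_
    rw [Fintype.sum_prod_type]
    refine Finset.sum_congr rfl fun c _ => ?_
    rw [Finset.mul_sum]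
    refine Finset.sum_congr rfl fun d _ => ?_
    rw [hJ, mul_assoc]
  have hsum : ∀ i, Summable fun t => ∫ ω, ‖γ ^ t * S.r (κ i) (x t ω i) (u t ω i)
        (marg (emp κ (x t ω))) (marg (emp κ (u t ω)))‖ ∂P := by
    intro i
    refine Summable.of_nonneg_of_le (fun t => integral_nonneg fun ω => norm_nonneg _) ?_
      ((summable_geometric_of_lt_one hγ0 hγ1).mul_right S.MR)
    intro t
    calc _ ≤ ∫ ω, γ ^ t * S.MR ∂P := by
          refine integral_mono (hint i t).norm (integrable_const _) fun ω => ?_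
          dsimp only
          rw [Real.norm_eq_abs, abs_mul, abs_of_nonneg (pow_nonneg hγ0 t)]
          exact mul_le_mul_of_nonneg_left (S.hrBdd _ _ _ _ _ (emp_prob _ _).marg
            (emp_prob _ _).marg) (pow_nonneg hγ0 t)
      _ = _ := by simp
  have h1 := fun i => hasSum_integral_of_summable_integral_norm (hint i) (hsum i)
  have h2 := (hasSum_sum (s := Finset.univ) fun i _ => h1 i).div_const (Fintype.card I : ℝ)
  have e : (fun t => γ ^ t * ∑ c, rho S κ x0 t c * ∑ d, Wt (pA S κ t c) d * RN S κ c d) =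
      fun t => (∑ i, ∫ ω, γ ^ t * S.r (κ i) (x t ω i) (u t ω i)
        (marg (emp κ (x t ω))) (marg (emp κ (u t ω))) ∂P) / (Fintype.card I : ℝ) := by
    funext t
    simp_rw [hval]
    rw [← Finset.mul_sum, mul_div_assoc]
    congr 1
    unfold RN
    rw [Finset.sum_comm, Finset.sum_div]
    refine Finset.sum_congr rfl fun c _ => ?_
    rw [← Finset.mul_sum, mul_div_assoc, Finset.sum_comm, Finset.sum_div]
    congr 1
    refine Finset.sum_congr rfl fun d _ => ?_
    rw [← Finset.mul_sum, mul_div_assoc]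
  rw [e]
  exact h2

lemma vMF_sum (γ : ℝ) (hγ0 : 0 ≤ γ) (hγ1 : γ < 1) (μ : ℕ → X × Fin K → ℝ) (hμ : ∀ t, IsProb (μ t)) :
    HasSum (fun t => γ ^ t * S.rM t (μ t))
      (∑ k, ∑' t : ℕ, γ ^ t * ∑ x, μ t (x, k) * S.avr t k x (marg (μ t)) (marg (S.nuM t (μ t)))) := by
  have hs : ∀ k, Summable fun t : ℕ =>
      γ ^ t * ∑ x, μ t (x, k) * S.avr t k x (marg (μ t)) (marg (S.nuM t (μ t))) := by
    intro k
    refine Summable.of_norm_bounded ((summable_geometric_of_lt_one hγ0 hγ1).mul_right S.MR) ?_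
    intro t
    rw [Real.norm_eq_abs, abs_mul, abs_of_nonneg (pow_nonneg hγ0 t)]
    refine mul_le_mul_of_nonneg_left ?_ (pow_nonneg hγ0 t)
    refine (Finset.abs_sum_le_sum_abs _ _).trans ?_
    calc _ ≤ ∑ x, μ t (x, k) * S.MR := by
          refine Finset.sum_le_sum fun x _ => ?_
          rw [abs_mul, abs_of_nonneg ((hμ t).1 _)]
          exact mul_le_mul_of_nonneg_left (MFS.avr_bdd t k x (hμ t).marg
            (MFS.nuM_prob t (hμ t)).marg) ((hμ t).1 _)
      _ ≤ ∑ k, ∑ x, μ t (x, k) * S.MR :=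
          Finset.single_le_sum (f := fun k => ∑ x, μ t (x, k) * S.MR)
            (fun k _ => Finset.sum_nonneg fun x _ => mul_nonneg ((hμ t).1 _) S.hMR)
            (Finset.mem_univ k)
      _ = (∑ p, μ t p) * S.MR := by
          rw [Fintype.sum_prod_type, Finset.sum_comm, Finset.sum_mul]
          simp_rw [Finset.sum_mul]
      _ = S.MR := by rw [(hμ t).2, one_mul]
  convert hasSum_sum (s := Finset.univ) fun k _ => (hs k).hasSum using 1
  funext t
  rw [← Finset.mul_sum]
  rfl

lemma aJ_nonneg (κ : I → Fin K) : 0 ≤ aJ κ :=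
  div_nonneg (Finset.sum_nonneg fun _ _ => Real.sqrt_nonneg _) (Nat.cast_nonneg _)

lemma final_bound (κ : I → Fin K) (x0 : I → X) (γ : ℝ) (hγ0 : 0 ≤ γ) (hγ1 : γ < 1)
    (SP SR : ℝ) (hSP : SP = S.SP1 + S.SP2) (hSR : SR = S.SR1 + S.SR2) (hγSP : γ * SP < 1)
    (err : ℕ → ℝ)
    (herr : ∀ t, |err t| ≤ S.LR * (Real.sqrt (Fintype.card U) * (1 / Real.sqrt (Fintype.card I)))
      + S.SR1 * eJ S κ x0 t + S.SR2 * eM S κ x0 t) :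
    |∑' t, γ ^ t * err t| ≤
      (S.MR + S.LR) / (1 - γ) * Real.sqrt (Fintype.card U) * (1 / Real.sqrt (Fintype.card I))
        + Real.sqrt ((Fintype.card X : ℝ) * Fintype.card U) * (γ * (2 + S.LP) / (1 - γ))
          * (S.SR1 * aJ κ + S.SR2 * (1 / Real.sqrt (Fintype.card I)))
        + (2 + S.LP) * (SR / (SP - 1)) * Real.sqrt ((Fintype.card X : ℝ) * Fintype.card U)
          * (γ / (1 - γ * SP) - γ / (1 - γ))
          * (S.SP1 * aJ κ + S.SP2 * (1 / Real.sqrt (Fintype.card I))) := by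
  have hMR := S.hMR
  have hLR := S.hLR
  have hLP := S.hLP
  have hLQ := S.hLQ
  have hSR1 : 0 ≤ S.SR1 := add_nonneg hMR hLR
  have hSR2 : 0 ≤ S.SR2 := by unfold MFS.SR2; positivity
  have hSP1 : 0 ≤ S.SP1 := by unfold MFS.SP1; positivity
  have hSP2 : 0 ≤ S.SP2 := by unfold MFS.SP2; positivity
  have ha := aJ_nonneg κ
  have hb : 0 ≤ 1 / Real.sqrt (Fintype.card I) := by positivity
  have hU : 0 ≤ Real.sqrt (Fintype.card U) := Real.sqrt_nonneg _
  have hg : 0 < 1 - γ := by linarith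
  have hE0 : S.LR * (Real.sqrt (Fintype.card U) * (1 / Real.sqrt (Fintype.card I))) / (1 - γ) ≤
      (S.MR + S.LR) / (1 - γ) * Real.sqrt (Fintype.card U) * (1 / Real.sqrt (Fintype.card I)) := by
    have : (S.MR + S.LR) / (1 - γ) * Real.sqrt (Fintype.card U) * (1 / Real.sqrt (Fintype.card I)) =
      (S.MR + S.LR) * (Real.sqrt (Fintype.card U) * (1 / Real.sqrt (Fintype.card I))) / (1 - γ) := by
      ring
    rw [this]
    refine div_le_div_of_nonneg_right ?_ hg.le
    exact mul_le_mul_of_nonneg_right (by linarith) (mul_nonneg hU hb)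
  have h0 := herr 0
  rw [eJ_zero, eM_zero, mul_zero, mul_zero, add_zero, add_zero] at h0
  have hX1 : 1 ≤ Real.sqrt (Fintype.card U) := by
    rw [Real.one_le_sqrt]; exact_mod_cast Fintype.card_pos
  set E0 := S.LR * (Real.sqrt (Fintype.card U) * (1 / Real.sqrt (Fintype.card I))) with hE0d
  set a := aJ κ with had
  set b := 1 / Real.sqrt (Fintype.card I) with hbd
  set V := Real.sqrt ((Fintype.card X : ℝ) * Fintype.card U) with hVd
  have hV0 : 0 ≤ V := Real.sqrt_nonneg _
  by_cases h1 : SP = 1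
  · have hP : S.LP = 0 := by
      unfold MFS.SP1 MFS.SP2 at hSP
      nlinarith [mul_nonneg hLP hLQ]
    have hQ : S.LQ = 0 := by
      unfold MFS.SP1 MFS.SP2 at hSP
      nlinarith [mul_nonneg hLP hLQ]
    have hXV : Real.sqrt (Fintype.card X) ≤ V := by
      rw [hVd, Real.sqrt_mul (Nat.cast_nonneg _)]
      exact le_mul_of_one_le_right (Real.sqrt_nonneg _) hX1
    have hW : 0 ≤ S.SR1 * a + S.SR2 * b := by positivity
    refine (series_bound γ hγ0 hγ1 0 le_rfl (by simp) E0
      (Real.sqrt (Fintype.card X) * (S.SR1 * a + S.SR2 * b)) 0 err h0 ?_).trans ?_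
    · intro t
      have e1 := mul_le_mul_of_nonneg_left (eJ_deg hP hQ κ x0 (t + 1)) hSR1
      have e2 := mul_le_mul_of_nonneg_left (eM_deg hP hQ κ x0 (t + 1)) hSR2
      have := herr (t + 1)
      rw [← had] at e1
      rw [← hbd] at e2
      linarith
    · rw [h1, sub_self, div_zero]
      simp only [mul_zero, zero_mul, add_zero]
      refine add_le_add hE0 ?_
      have : V * (γ * (2 + S.LP) / (1 - γ)) * (S.SR1 * a + S.SR2 * b) =
        γ / (1 - γ) * ((2 + S.LP) * V * (S.SR1 * a + S.SR2 * b)) := by ring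
      rw [this]
      refine mul_le_mul_of_nonneg_left (mul_le_mul_of_nonneg_right ?_ hW) (div_nonneg hγ0 hg.le)
      nlinarith
  · have hSP1' : 1 < SP := by
      refine lt_of_le_of_ne ?_ (Ne.symm h1)
      rw [hSP]; unfold MFS.SP1; linarith
    have hne : SP - 1 ≠ 0 := by linarith
    set D := (2 + S.LP) * V with hD
    have hq : ∀ t, S.SP1 * eJ S κ x0 t + S.SP2 * eM S κ x0 t ≤
        D * (S.SP1 * a + S.SP2 * b) / (SP - 1) * (SP ^ t - 1) := by
      intro t
      induction t with
      | zero => simp [eJ_zero, eM_zero]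
      | succ t ih =>
        have e1 := mul_le_mul_of_nonneg_left (recJ (S := S) κ x0 t) hSP1
        have e2 := mul_le_mul_of_nonneg_left (recM (S := S) κ x0 t) hSP2
        rw [← hVd, ← hD, ← had] at e1
        rw [← hVd, ← hD, ← hbd] at e2
        have e3 := mul_le_mul_of_nonneg_left ih (by linarith : 0 ≤ SP)
        have e4 : D * (S.SP1 * a + S.SP2 * b) / (SP - 1) * (SP ^ (t + 1) - 1) =
          D * (S.SP1 * a + S.SP2 * b) +
            SP * (D * (S.SP1 * a + S.SP2 * b) / (SP - 1) * (SP ^ t - 1)) := by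
          field_simp
          ring
        rw [e4]
        refine le_trans ?_ (add_le_add_right e3 _)
        rw [hSP]
        linarith
    refine (series_bound γ hγ0 hγ1 SP (by linarith) hγSP E0
      (D * (S.SR1 * a + S.SR2 * b)) (SR * (D * (S.SP1 * a + S.SP2 * b) / (SP - 1))) err h0 ?_).trans ?_
    · intro t
      have e1 := mul_le_mul_of_nonneg_left (recJ (S := S) κ x0 t) hSR1
      have e2 := mul_le_mul_of_nonneg_left (recM (S := S) κ x0 t) hSR2
      rw [← hVd, ← hD, ← had] at e1
      rw [← hVd, ← hD, ← hbd] at e2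
      have e3 := mul_le_mul_of_nonneg_left (hq t) (by rw [hSR]; linarith : 0 ≤ SR)
      have := herr (t + 1)
      refine this.trans ?_
      rw [mul_assoc SR]
      refine le_trans ?_ (add_le_add_right e3 _)
      rw [hSR]
      linarith
    · have e : γ / (1 - γ) * (D * (S.SR1 * a + S.SR2 * b)) =
        V * (γ * (2 + S.LP) / (1 - γ)) * (S.SR1 * a + S.SR2 * b) := by rw [hD]; ring
      have e' : SR * (D * (S.SP1 * a + S.SP2 * b) / (SP - 1)) * (γ / (1 - γ * SP) - γ / (1 - γ)) =
        (2 + S.LP) * (SR / (SP - 1)) * V * (γ / (1 - γ * SP) - γ / (1 - γ))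
          * (S.SP1 * a + S.SP2 * b) := by rw [hD]; ring
      rw [e, e']
      linarith

end CoreI


lemma emp_sigma {A : Type*} [Fintype A] [DecidableEq A] {K : ℕ} (N : Fin K → ℕ)
    (c : (k : Fin K) → Fin (N k) → A) (a : A) (k : Fin K) :
    emp (fun i : (k : Fin K) × Fin (N k) => i.1) (fun i => c i.1 i.2) (a, k) =
      (∑ j, if c k j = a then (1 : ℝ) else 0) / (Fintype.card ((k : Fin K) × Fin (N k)) : ℝ) := by
  unfold emp
  rw [Fintype.sum_sigma]
  congr 1
  rw [Finset.sum_eq_single k]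
  · simp
  · intro b _ hb
    simp [hb]
  · simp

theorem stmt11 {Ω : Type*} [MeasurableSpace Ω] (P : Measure Ω) [IsProbabilityMeasure P]
    {X U : Type*} [Fintype X] [Fintype U] [Nonempty X] [Nonempty U]
    [DecidableEq X] [DecidableEq U]
    [MeasurableSpace X] [MeasurableSingletonClass X]
    [MeasurableSpace U] [MeasurableSingletonClass U]
    (K : ℕ) (hK : 0 < K) (N : Fin K → ℕ) (hN : ∀ k, 0 < N k)
    (Npop : ℝ) (hNpop : Npop = ∑ k, (N k : ℝ))
    (γ : ℝ) (hγ0 : 0 ≤ γ) (hγ1 : γ < 1)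
    (MR LR LP LQ : ℝ) (hMR : 0 ≤ MR) (hLR : 0 ≤ LR) (hLP : 0 ≤ LP) (hLQ : 0 ≤ LQ)
    -- the reward functions, depending only on aggregate (marginal) distributions
    (r : Fin K → X → U → (X → ℝ) → (U → ℝ) → ℝ)
    (hrBdd : ∀ k x u m n, IsProb m → IsProb n → |r k x u m n| ≤ MR)
    (hrLip : ∀ k x u m₁ n₁ m₂ n₂, IsProb m₁ → IsProb n₁ → IsProb m₂ → IsProb n₂ →
      |r k x u m₁ n₁ - r k x u m₂ n₂| ≤ LR * (l1 m₁ m₂ + l1 n₁ n₂))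
    -- the transition kernels
    (Pk : Fin K → X → U → (X → ℝ) → (U → ℝ) → X → ℝ)
    (hPkProb : ∀ k x u m n, IsProb m → IsProb n → IsProb (Pk k x u m n))
    (hPkLip : ∀ k x u m₁ n₁ m₂ n₂, IsProb m₁ → IsProb n₁ → IsProb m₂ → IsProb n₂ →
      l1 (Pk k x u m₁ n₁) (Pk k x u m₂ n₂) ≤ LP * (l1 m₁ m₂ + l1 n₁ n₂))
    -- the policy
    (pi : ℕ → Fin K → X → (X → ℝ) → U → ℝ)
    (hpiProb : ∀ t k x m, IsProb m → IsProb (pi t k x m))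
    (hpiLip : ∀ t k x m₁ m₂, IsProb m₁ → IsProb m₂ →
      l1 (pi t k x m₁) (pi t k x m₂) ≤ LQ * l1 m₁ m₂)
    -- empirical joint state and action distributions of a configuration
    (empX : ((k : Fin K) → Fin (N k) → X) → X × Fin K → ℝ)
    (hempX : ∀ c x0 k, empX c (x0, k) = (∑ j, if c k j = x0 then (1 : ℝ) else 0) / Npop)
    (empU : ((k : Fin K) → Fin (N k) → U) → U × Fin K → ℝ)
    (hempU : ∀ c u0 k, empU c (u0, k) = (∑ j, if c k j = u0 then (1 : ℝ) else 0) / Npop)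
    -- the N-agent process
    (x0 : (k : Fin K) → Fin (N k) → X)
    (xpr : ℕ → (k : Fin K) → Fin (N k) → Ω → X)
    (upr : ℕ → (k : Fin K) → Fin (N k) → Ω → U)
    (hmeasx : ∀ t k j, Measurable (xpr t k j))
    (hmeasu : ∀ t k j, Measurable (upr t k j))
    (hx0 : ∀ k j ω, xpr 0 k j ω = x0 k j)
    (hlaw : ∀ (T : ℕ) (Xs : ℕ → (k : Fin K) → Fin (N k) → X)
        (Us : ℕ → (k : Fin K) → Fin (N k) → U), (∀ k j, Xs 0 k j = x0 k j) →
      P {ω | ∀ t ≤ T, (∀ k j, xpr t k j ω = Xs t k j) ∧ ∀ k j, upr t k j ω = Us t k j}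
        = ENNReal.ofReal
            ((∏ t ∈ Finset.range (T + 1), ∏ k, ∏ j,
                pi t k (Xs t k j) (marg (empX (Xs t))) (Us t k j))
              * ∏ t ∈ Finset.range T, ∏ k, ∏ j,
                  Pk k (Xs t k j) (Us t k j) (marg (empX (Xs t))) (marg (empU (Us t)))
                    (Xs (t + 1) k j)))
    -- the value of the policy in the N-agent system
    (vN : ℝ)
    (hvN : vN = (1 / Npop) * ∑ k, ∑ j, ∫ ω, ∑' t : ℕ,
      γ ^ t * r k (xpr t k j ω) (upr t k j ω)
        (marg (empX (fun k' j' => xpr t k' j' ω)))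
        (marg (empU (fun k' j' => upr t k' j' ω))) ∂P)
    -- the deterministic mean-field flow started from the empirical joint
    -- distribution of the initial states
    (nuMF : ℕ → (X × Fin K → ℝ) → U × Fin K → ℝ)
    (hnuMF : ∀ t μ u0 k, nuMF t μ (u0, k) = ∑ x, pi t k x (marg μ) u0 * μ (x, k))
    (muSeq : ℕ → X × Fin K → ℝ)
    (hmu0 : muSeq 0 = empX x0)
    (hmuStep : ∀ t x1 k, muSeq (t + 1) (x1, k) =
      ∑ x, ∑ u0, muSeq t (x, k) * pi t k x (marg (muSeq t)) u0 *
        Pk k x u0 (marg (muSeq t)) (marg (nuMF t (muSeq t))) x1)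
    (rMF : ℕ → Fin K → ℝ)
    (hrMF : ∀ t k, rMF t k = ∑ x, ∑ u0,
      muSeq t (x, k) * pi t k x (marg (muSeq t)) u0 *
        r k x u0 (marg (muSeq t)) (marg (nuMF t (muSeq t))))
    -- the mean-field value
    (vMF : ℝ)
    (hvMF : vMF = ∑ k, ∑' t : ℕ, γ ^ t * rMF t k)
    -- the constants
    (CR CP SR' SR'' SP' SP'' SR SP : ℝ)
    (hCR : CR = MR + LR) (hCP : CP = 2 + LP)
    (hSR' : SR' = MR + LR) (hSR'' : SR'' = MR * LQ + LR * (1 + LQ))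
    (hSP' : SP' = 1 + LP) (hSP'' : SP'' = LQ + LP * (1 + LQ))
    (hSR : SR = SR' + SR'') (hSP : SP = SP' + SP'')
    (hγSP : γ * SP < 1) :
    |vN - vMF|
      ≤ CR / (1 - γ) * Real.sqrt (Fintype.card U) * (1 / Real.sqrt Npop)
        + Real.sqrt ((Fintype.card X : ℝ) * Fintype.card U) * (γ * CP / (1 - γ))
          * ((SR' / Npop) * (∑ k, Real.sqrt (N k)) + SR'' / Real.sqrt Npop)
        + CP * (SR / (SP - 1)) * Real.sqrt ((Fintype.card X : ℝ) * Fintype.card U)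
          * (γ / (1 - γ * SP) - γ / (1 - γ))
          * ((SP' / Npop) * (∑ k, Real.sqrt (N k)) + SP'' / Real.sqrt Npop) := by
  let S : MFS X U K := ⟨MR, LR, LP, LQ, hMR, hLR, hLP, hLQ, r, hrBdd, hrLip, Pk, hPkProb, hPkLip,
    pi, hpiProb, hpiLip⟩
  let I := (k : Fin K) × Fin (N k)
  haveI : Nonempty I := ⟨⟨⟨0, hK⟩, ⟨0, hN _⟩⟩⟩
  let κ : I → Fin K := fun i => i.1
  have hcard : (Fintype.card I : ℝ) = Npop := by
    rw [hNpop, Fintype.card_sigma]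
    simp
  have hEX : ∀ c, empX c = emp κ (fun i : I => c i.1 i.2) := by
    intro c
    funext p
    obtain ⟨a, k⟩ := p
    rw [hempX, ← hcard]
    exact (emp_sigma N c a k).symm
  have hEU : ∀ c, empU c = emp κ (fun i : I => c i.1 i.2) := by
    intro c
    funext p
    obtain ⟨a, k⟩ := p
    rw [hempU, ← hcard]
    exact (emp_sigma N c a k).symm
  let xI : ℕ → Ω → I → X := fun t ω i => xpr t i.1 i.2 ω
  let uI : ℕ → Ω → I → U := fun t ω i => upr t i.1 i.2 ω
  let x0I : I → X := fun i => x0 i.1 i.2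
  have hx : ∀ t c, MeasurableSet (xI t ⁻¹' {c}) := by
    intro t c
    have : xI t ⁻¹' {c} = ⋂ i : I, xpr t i.1 i.2 ⁻¹' {c i} := by
      ext ω
      simp only [Set.mem_preimage, Set.mem_singleton_iff, Set.mem_iInter]
      exact funext_iff
    rw [this]
    exact MeasurableSet.iInter fun i => hmeasx _ _ _ (measurableSet_singleton _)
  have hu : ∀ t c, MeasurableSet (uI t ⁻¹' {c}) := by
    intro t c
    have : uI t ⁻¹' {c} = ⋂ i : I, upr t i.1 i.2 ⁻¹' {c i} := by
      ext ω
      simp only [Set.mem_preimage, Set.mem_singleton_iff, Set.mem_iInter]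
      exact funext_iff
    rw [this]
    exact MeasurableSet.iInter fun i => hmeasu _ _ _ (measurableSet_singleton _)
  have hxI0 : ∀ ω, xI 0 ω = x0I := fun ω => funext fun i => hx0 i.1 i.2 ω
  have hlawI : ∀ (T : ℕ) (Xs : ℕ → I → X) (Us : ℕ → I → U), Xs 0 = x0I →
      P {ω | ∀ t ≤ T, xI t ω = Xs t ∧ uI t ω = Us t} = ENNReal.ofReal
        ((∏ t ∈ Finset.range (T + 1), Wt (pA S κ t (Xs t)) (Us t)) *
          ∏ t ∈ Finset.range T, Wt (pB S κ (Xs t) (Us t)) (Xs (t + 1))) := by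
    intro T Xs Us h
    have h1 := hlaw T (fun t k j => Xs t ⟨k, j⟩) (fun t k j => Us t ⟨k, j⟩)
      (fun k j => congrFun h ⟨k, j⟩)
    have hset : {ω | ∀ t ≤ T, xI t ω = Xs t ∧ uI t ω = Us t} =
        {ω | ∀ t ≤ T, (∀ k j, xpr t k j ω = Xs t ⟨k, j⟩) ∧ ∀ k j, upr t k j ω = Us t ⟨k, j⟩} := by
      ext ω
      simp only [Set.mem_setOf_eq, funext_iff, xI, uI, I, Sigma.forall]
    rw [hset, h1]
    simp only [hEX, hEU]
    congr 2
    · refine Finset.prod_congr rfl fun t _ => ?_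
      unfold Wt
      rw [Fintype.prod_sigma]
      rfl
    · refine Finset.prod_congr rfl fun t _ => ?_
      unfold Wt
      rw [Fintype.prod_sigma]
      rfl
  have hnu : ∀ t μ, nuMF t μ = S.nuM t μ := by
    intro t μ
    funext p
    obtain ⟨a, k⟩ := p
    rw [hnuMF]
    exact Finset.sum_congr rfl fun x _ => mul_comm _ _
  have hmu : ∀ t, muSeq t = muF S (emp κ x0I) t := by
    intro t
    induction t with
    | zero => rw [hmu0, hEX]; rfl
    | succ t ih =>
      funext p
      obtain ⟨a, k⟩ := p
      rw [hmuStep, hnu, ih]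
      refine Finset.sum_congr rfl fun x _ => ?_
      unfold MFS.avP
      rw [Finset.mul_sum]
      exact Finset.sum_congr rfl fun x _ => mul_assoc _ _ _
  have hr : ∀ t k, rMF t k = ∑ x, muF S (emp κ x0I) t (x, k) * S.avr t k x
      (marg (muF S (emp κ x0I) t)) (marg (S.nuM t (muF S (emp κ x0I) t))) := by
    intro t k
    rw [hrMF, hnu, hmu]
    refine Finset.sum_congr rfl fun x _ => ?_
    unfold MFS.avr
    rw [Finset.mul_sum]
    exact Finset.sum_congr rfl fun x _ => mul_assoc _ _ _
  have hv1 := vN_hasSum P S κ x0I xI uI hx hu hxI0 hlawI γ hγ0 hγ1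
  have hv2 := vMF_sum S γ hγ0 hγ1 (muF S (emp κ x0I)) (muF_prob (emp_prob κ x0I))
  have e1 : vN = (∑ i : I, ∫ ω, ∑' t : ℕ, γ ^ t * S.r (κ i) (xI t ω i) (uI t ω i)
      (marg (emp κ (xI t ω))) (marg (emp κ (uI t ω))) ∂P) / (Fintype.card I : ℝ) := by
    rw [hvN, hcard, one_div, inv_mul_eq_div, Fintype.sum_sigma]
    simp only [hEX, hEU]
    rfl
  have e2 : vMF = ∑ k, ∑' t : ℕ, γ ^ t * ∑ x, muF S (emp κ x0I) t (x, k) * S.avr t k x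
      (marg (muF S (emp κ x0I) t)) (marg (S.nuM t (muF S (emp κ x0I) t))) := by
    rw [hvMF]
    simp only [hr]
  rw [← e1] at hv1
  rw [← e2] at hv2
  have h3 := (hv1.sub hv2).tsum_eq
  simp only [← mul_sub] at h3
  have hfin := final_bound S κ x0I γ hγ0 hγ1 SP SR (by rw [hSP, hSP', hSP'']; rfl)
    (by rw [hSR, hSR', hSR'']; rfl) hγSP _ (fun t => reward_err κ x0I t)
  rw [h3] at hfin
  have ha : aJ κ = (∑ k, Real.sqrt (N k)) / Npop := by
    unfold aJ
    rw [hcard]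
    congr 1
    refine Finset.sum_congr rfl fun k _ => ?_
    congr 1
    rw [Fintype.sum_sigma, Finset.sum_eq_single k]
    · simp [κ]
    · intro b _ hb
      simp [κ, hb]
    · simp
  rw [ha, hcard] at hfin
  have f1 : SR' / Npop * (∑ k, Real.sqrt (N k)) + SR'' / Real.sqrt Npop =
      S.SR1 * ((∑ k, Real.sqrt (N k)) / Npop) + S.SR2 * (1 / Real.sqrt Npop) := by
    have g1 : S.SR1 = SR' := hSR'.symm
    have g2 : S.SR2 = SR'' := hSR''.symm
    rw [g1, g2]
    ring
  have f2 : SP' / Npop * (∑ k, Real.sqrt (N k)) + SP'' / Real.sqrt Npop =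
      S.SP1 * ((∑ k, Real.sqrt (N k)) / Npop) + S.SP2 * (1 / Real.sqrt Npop) := by
    have g1 : S.SP1 = SP' := hSP'.symm
    have g2 : S.SP2 = SP'' := hSP''.symm
    rw [g1, g2]
    ring
  rw [f1, f2, hCR, hCP]
  exact hfin
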